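/- arXiv:1909.02874 — 2 statements merged into one kernel-verified Lean document; each statement's English description precedes it below -/
import Mathlib

section
/- Let e_m denote the infimum of η(P) over all convex polyhedra P inscribed in the unit sphere S² in ℝ³ having exactly m faces, all of which are triangles. Then liminf_{m→∞} e_m ≤ 2·sin(36°) = 2·sin(π/5). -/
open scoped Real
open Filter

noncomputable section

abbrev E3 := EuclideanSpace ℝ (Fin 3)

/-- `F` is a face of dimension `d` of the convex body `P`:
a nonempty convex extreme subset whose affine hull has dimension `d`. -/
def IsFaceDim (P F : Set E3) (d : ℕ) : Prop :=
  F.Nonempty ∧ Convex ℝ F ∧ IsExtreme ℝ P F ∧ Module.finrank ℝ (vectorSpan ℝ F) = d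

/-- A convex polyhedron inscribed in the unit sphere `S²` in `ℝ³`, given as the convex hull
of a finite vertex set `V ⊆ S²` each point of which is an extreme point of the hull,
which is three-dimensional, all of whose 2-dimensional faces are triangles,
and which has exactly `m` faces (2-dimensional faces). -/
structure InscribedTriPoly (m : ℕ) where
  V : Finset E3
  on_sphere : ∀ v ∈ V, ‖v‖ = 1
  is_vertex : ∀ v ∈ V, v ∈ Set.extremePoints ℝ (convexHull ℝ (V : Set E3))
  full_dim : affineSpan ℝ (V : Set E3) = ⊤
  faces_triangles : ∀ F : Set E3, IsFaceDim (convexHull ℝ (V : Set E3)) F 2 →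
      ∃ a b c : E3, a ∈ V ∧ b ∈ V ∧ c ∈ V ∧ AffineIndependent ℝ ![a, b, c] ∧
        F = convexHull ℝ ({a, b, c} : Set E3)
  card_faces : {F : Set E3 | IsFaceDim (convexHull ℝ (V : Set E3)) F 2}.ncard = m

/-- The set of lengths of the edges (1-dimensional faces) of the polytope `conv V`. -/
def edgeLengths (V : Finset E3) : Set ℝ :=
  {d : ℝ | ∃ p q : E3, p ≠ q ∧ IsFaceDim (convexHull ℝ (V : Set E3)) (segment ℝ p q) 1 ∧
    d = dist p q}

/-- `η` : quotient of the longest edge length by the shortest edge length. -/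
def eta (V : Finset E3) : ℝ := sSup (edgeLengths V) / sInf (edgeLengths V)

/-- `e m` : the infimum of `η P` over all convex polyhedra `P` inscribed in the unit
sphere with exactly `m` faces, all triangles. -/
def e (m : ℕ) : ℝ := sInf {x : ℝ | ∃ P : InscribedTriPoly m, x = eta P.V}

section

open EuclideanGeometry

theorem affineIndependent_of_dist_sq_mem_Icc {V P : Type*} [NormedAddCommGroup V]
    [InnerProductSpace ℝ V] [MetricSpace P] [NormedAddTorsor V P] (p : Fin 4 → P) {m M : ℝ}
    (hM : M < 2 * m)
    (h : ∀ i j, i ≠ j → m ≤ dist (p i) (p j) ^ 2 ∧ dist (p i) (p j) ^ 2 ≤ M) :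
    AffineIndependent ℝ p := by
  rw [affineIndependent_iff_of_fintype]
  intro w hw h0
  have key := inner_weightedVSub (s₁ := Finset.univ) (s₂ := Finset.univ) p hw p hw
  rw [h0, inner_zero_left] at key
  have hmM : m ≤ M := (h 0 1 (by decide)).1.trans (h 0 1 (by decide)).2
  have pair : ∀ i j, i ≠ j →
      w i * w j * (dist (p i) (p j) ^ 2 - (m + M) / 2) ≤
        (M - m) / 2 * ((w i ^ 2 + w j ^ 2) / 2) := by
    intro i j hij
    obtain ⟨h1, h2⟩ := h i j hij
    have h3 : |w i * w j| ≤ (w i ^ 2 + w j ^ 2) / 2 := by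
      rw [abs_le]; constructor <;> nlinarith [sq_nonneg (w i + w j), sq_nonneg (w i - w j)]
    calc w i * w j * (dist (p i) (p j) ^ 2 - (m + M) / 2)
        ≤ |w i * w j * (dist (p i) (p j) ^ 2 - (m + M) / 2)| := le_abs_self _
      _ = |dist (p i) (p j) ^ 2 - (m + M) / 2| * |w i * w j| := by rw [abs_mul, mul_comm]
      _ ≤ (M - m) / 2 * ((w i ^ 2 + w j ^ 2) / 2) := by
        apply mul_le_mul _ h3 (abs_nonneg _) (by linarith)
        rw [abs_le]; constructor <;> linarith
  have h01 := pair 0 1 (by decide)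
  have h02 := pair 0 2 (by decide)
  have h03 := pair 0 3 (by decide)
  have h12 := pair 1 2 (by decide)
  have h13 := pair 1 3 (by decide)
  have h23 := pair 2 3 (by decide)
  simp only [Fin.sum_univ_four, dist_self, mul_zero, zero_add, add_zero] at key hw
  rw [dist_comm (p 1) (p 0), dist_comm (p 2) (p 0), dist_comm (p 3) (p 0), dist_comm (p 2) (p 1),
    dist_comm (p 3) (p 1), dist_comm (p 3) (p 2)] at key
  have hsq : (m + M) / 2 * (w 0 + w 1 + w 2 + w 3) ^ 2 = 0 := by rw [hw]; ring
  have hle : (w 0 ^ 2 + w 1 ^ 2 + w 2 ^ 2 + w 3 ^ 2) * (2 * m - M) ≤ 0 := by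
    linarith
  have hle' : w 0 ^ 2 + w 1 ^ 2 + w 2 ^ 2 + w 3 ^ 2 ≤ 0 := by
    by_contra hc
    push Not at hc
    nlinarith [mul_pos hc (sub_pos.2 hM)]
  intro i
  have : w i ^ 2 ≤ 0 := by
    refine le_trans ?_ hle'
    rw [← Fin.sum_univ_four (fun j => w j ^ 2)]
    exact Finset.single_le_sum (f := fun j => w j ^ 2) (fun j _ => sq_nonneg _) (Finset.mem_univ i)
  exact pow_eq_zero_iff (two_ne_zero) |>.1 (le_antisymm this (sq_nonneg _))

theorem IsExtreme.eq_convexHull_inter {E : Type*} [AddCommGroup E] [Module ℝ E] {V F : Set E}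
    (hF : IsExtreme ℝ (convexHull ℝ V) F) (hc : Convex ℝ F) :
    F = convexHull ℝ (F ∩ V) := by
  apply Set.Subset.antisymm _ (convexHull_min Set.inter_subset_left hc)
  intro x hx
  have hxP := hF.subset hx
  have hsub : convexHull ℝ (V \ F) ⊆ convexHull ℝ V \ F :=
    convexHull_min (fun v hv => ⟨subset_convexHull ℝ _ hv.1, hv.2⟩)
      (hF.convex_sdiff (convex_convexHull ℝ V))
  rcases (V \ F).eq_empty_or_nonempty with h1 | h1
  · rwa [Set.inter_eq_right.2 (Set.sdiff_eq_empty.1 h1)]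
  rcases (F ∩ V).eq_empty_or_nonempty with h2 | h2
  · rw [sdiff_eq_left.2 (Set.disjoint_iff_inter_eq_empty.2 (by rwa [Set.inter_comm]))] at hsub
    exact absurd hx (hsub hxP).2
  have hV : V = (F ∩ V) ∪ (V \ F) := by
    rw [Set.inter_comm, Set.inter_union_sdiff]
  rw [hV, convexHull_union h2 h1, mem_convexJoin] at hxP
  obtain ⟨t, ht, u, hu, hxs⟩ := hxP
  have huF := hsub hu
  rw [← insert_endpoints_openSegment] at hxs
  rcases hxs with rfl | rfl | hxs
  · exact ht
  · exact absurd hx huF.2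
  · exact absurd (hF.right_mem_of_mem_openSegment
      (convexHull_mono Set.inter_subset_right ht) huF.1 hx hxs) huF.2

theorem IsExtreme.disjoint_interior {P F : Set E3} (hF : IsExtreme ℝ P F)
    (h3 : Module.finrank ℝ (vectorSpan ℝ F) < 3) : Disjoint (interior P) F := by
  rw [Set.disjoint_left]
  intro z hz hzF
  have hPF : P ⊆ F := by
    intro y hy
    have hcont : Tendsto (fun t : ℝ => z + t • (z - y)) (nhdsWithin 0 (Set.Ioi 0)) (nhds z) := by
      have : Continuous (fun t : ℝ => z + t • (z - y)) := by fun_prop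
      have h := this.tendsto 0
      simp only [zero_smul, add_zero] at h
      exact h.mono_left nhdsWithin_le_nhds
    have hev := (hcont.eventually (isOpen_interior.mem_nhds hz)).and self_mem_nhdsWithin
    obtain ⟨t, ht, ht0⟩ := hev.exists
    have ht0 : 0 < t := ht0
    refine hF.left_mem_of_mem_openSegment hy (interior_subset ht) hzF
      ⟨t / (1 + t), 1 / (1 + t), by positivity, by positivity, by field_simp; ring, ?_⟩
    rw [smul_add, smul_smul, smul_sub]
    have h1 : (1 / (1 + t) : ℝ) * t = t / (1 + t) := by ring
    have h2 : (1 / (1 + t) : ℝ) = 1 - t / (1 + t) := by field_simp; ring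
    rw [h1, h2]
    module
  have hne : (interior P).Nonempty := ⟨z, hz⟩
  have htop : vectorSpan ℝ P = ⊤ := by
    apply AffineSubspace.vectorSpan_eq_top_of_affineSpan_eq_top
    have h := isOpen_interior.affineSpan_eq_top hne
    exact top_le_iff.1 (h ▸ affineSpan_mono ℝ interior_subset)
  have := top_le_iff.1 (htop ▸ vectorSpan_mono ℝ hPF)
  rw [this, finrank_top, finrank_euclideanSpace, Fintype.card_fin] at h3
  exact lt_irrefl _ h3

theorem IsExtreme.exists_support {P F : Set E3} (hP : Convex ℝ P) (hint : (interior P).Nonempty)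
    (hF : IsExtreme ℝ P F) (hc : Convex ℝ F) (hne : F.Nonempty)
    (h3 : Module.finrank ℝ (vectorSpan ℝ F) < 3) :
    ∃ c : E3, ‖c‖ = 1 ∧ ∃ h : ℝ, (∀ x ∈ P, inner ℝ c x ≤ h) ∧ ∀ x ∈ F, inner ℝ c x = h := by
  obtain ⟨f, u, hfu, huf⟩ := geometric_hahn_banach_open hP.interior isOpen_interior hc
    (hF.disjoint_interior h3)
  obtain ⟨z, hz⟩ := hint
  obtain ⟨y, hy⟩ := hne
  have hf0 : f ≠ 0 := by
    rintro rfl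
    have h1 := hfu z hz
    have h2 := huf y hy
    simp at h1 h2
    linarith
  have hPu : ∀ x ∈ P, f x ≤ u := by
    intro x hx
    have hx' : x ∈ closure (interior P) := by
      rw [hP.closure_interior_eq_closure_of_nonempty_interior ⟨z, hz⟩]
      exact subset_closure hx
    exact closure_minimal (s := interior P) (t := {x | f x ≤ u}) (fun a ha => (hfu a ha).le)
      (isClosed_le f.continuous continuous_const) hx'
  set n := (InnerProductSpace.toDual ℝ E3).symm f with hn
  have hfn : ∀ x, inner ℝ n x = f x := fun x => by
    rw [hn, InnerProductSpace.toDual_symm_apply]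
  have hn0 : n ≠ 0 := by
    intro h
    exact hf0 (by simpa [hn] using h)
  have hnp : 0 < ‖n‖ := norm_pos_iff.2 hn0
  refine ⟨‖n‖⁻¹ • n, by rw [norm_smul, norm_inv, norm_norm, inv_mul_cancel₀ hnp.ne'],
    ‖n‖⁻¹ * u, fun x hx => ?_, fun x hx => ?_⟩
  · rw [real_inner_smul_left, hfn]
    exact mul_le_mul_of_nonneg_left (hPu x hx) (by positivity)
  · rw [real_inner_smul_left, hfn, le_antisymm (hPu x (hF.subset hx)) (huf x hx)]

end

/-- Finite sets of unit vectors with separation `s`, covering radius `ρ`, and no distance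
strictly between `κ * s` and `2 * ρ`. -/
structure IsNet (V : Finset E3) (s ρ κ : ℝ) : Prop where
  norm_eq : ∀ v ∈ V, ‖v‖ = 1
  pos : 0 < s
  lt_one : ρ < 1
  sq_lt : κ ^ 2 < 2
  sep : ∀ A ∈ V, ∀ B ∈ V, A ≠ B → s ≤ dist A B ∧ (dist A B ≤ κ * s ∨ 2 * ρ < dist A B)
  cov : ∀ c : E3, ‖c‖ = 1 → ∃ v ∈ V, dist c v ≤ ρ

theorem dist_sq_eq_of_norm_eq_one {c v : E3} (hc : ‖c‖ = 1) (hv : ‖v‖ = 1) :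
    dist c v ^ 2 = 2 - 2 * inner ℝ c v := by
  rw [dist_eq_norm, norm_sub_sq_real, hc, hv]; ring

namespace IsNet

variable {V : Finset E3} {s ρ κ : ℝ}

theorem exists_half_lt_inner (hN : IsNet V s ρ κ) {c : E3} (hc : ‖c‖ = 1) :
    ∃ v ∈ V, 1 / 2 < inner ℝ c v := by
  obtain ⟨v, hv, hd⟩ := hN.cov c hc
  refine ⟨v, hv, ?_⟩
  have := dist_sq_eq_of_norm_eq_one hc (hN.norm_eq v hv)
  have h1 := hN.lt_one
  nlinarith [dist_nonneg (x := c) (y := v)]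

theorem dist_le_of_support (hN : IsNet V s ρ κ) {c : E3} (hc : ‖c‖ = 1) {h : ℝ}
    (hle : ∀ v ∈ V, inner ℝ c v ≤ h) {A B : E3} (hA : A ∈ V) (hB : B ∈ V)
    (hcA : inner ℝ c A = h) (hcB : inner ℝ c B = h) (hAB : A ≠ B) :
    s ≤ dist A B ∧ dist A B ≤ κ * s := by
  obtain ⟨h1, h2⟩ := hN.sep A hA B hB hAB
  refine ⟨h1, h2.resolve_right fun hlt => ?_⟩
  obtain ⟨v, hv, hd⟩ := hN.cov c hc
  have key : ∀ X ∈ V, inner ℝ c X = h → dist c X ≤ ρ := by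
    intro X hX hcX
    have e1 := dist_sq_eq_of_norm_eq_one hc (hN.norm_eq X hX)
    have e2 := dist_sq_eq_of_norm_eq_one hc (hN.norm_eq v hv)
    have e3 := hle v hv
    refine le_trans ?_ hd
    apply le_of_sq_le_sq _ dist_nonneg
    linarith
  have := dist_triangle_left A B c
  linarith [key A hA hcA, key B hB hcB]

theorem vectorSpan_eq_top (hN : IsNet V s ρ κ) : vectorSpan ℝ (V : Set E3) = ⊤ := by
  rw [← Submodule.orthogonal_eq_bot_iff, Submodule.eq_bot_iff]
  intro n hn
  by_contra hn0
  have hnp : 0 < ‖n‖ := norm_pos_iff.2 hn0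
  have hu : ‖‖n‖⁻¹ • n‖ = 1 := by rw [norm_smul, norm_inv, norm_norm, inv_mul_cancel₀ hnp.ne']
  obtain ⟨v, hv, h1⟩ := hN.exists_half_lt_inner hu
  obtain ⟨w, hw, h2⟩ := hN.exists_half_lt_inner (c := -(‖n‖⁻¹ • n)) (by rw [norm_neg, hu])
  have h3 : inner ℝ (v - w) n = 0 :=
    (Submodule.mem_orthogonal _ _).1 hn _ (vsub_mem_vectorSpan ℝ hv hw)
  rw [inner_neg_left] at h2
  rw [real_inner_smul_left] at h1 h2
  rw [inner_sub_left, real_inner_comm, real_inner_comm n w, sub_eq_zero] at h3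
  rw [h3] at h1
  linarith

theorem nonempty (hN : IsNet V s ρ κ) : V.Nonempty := by
  obtain ⟨v, hv, -⟩ := hN.cov (EuclideanSpace.single 0 1) (by simp)
  exact ⟨v, hv⟩

theorem affineSpan_eq_top (hN : IsNet V s ρ κ) : affineSpan ℝ (V : Set E3) = ⊤ :=
  (AffineSubspace.affineSpan_eq_top_iff_vectorSpan_eq_top_of_nonempty ℝ E3 E3
    (by simpa using hN.nonempty)).2 hN.vectorSpan_eq_top

theorem mem_extremePoints (hN : IsNet V s ρ κ) {v : E3} (hv : v ∈ V) :
    v ∈ Set.extremePoints ℝ (convexHull ℝ (V : Set E3)) := by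
  have hsub : convexHull ℝ (V : Set E3) ⊆ Metric.closedBall 0 1 :=
    convexHull_min (fun w hw => by simp [hN.norm_eq w hw]) (convex_closedBall _ _)
  refine inter_extremePoints_subset_extremePoints_of_subset hsub
    ⟨subset_convexHull ℝ _ hv, ?_⟩
  rw [mem_extremePoints_iff_left]
  refine ⟨by simp [hN.norm_eq v hv], fun x hx y hy hxy => ?_⟩
  by_contra hne
  have hxy' : x ≠ y := by
    rintro rfl
    rw [openSegment_same] at hxy
    exact hne hxy.symm
  have := (strictConvex_closedBall ℝ (0 : E3) 1).openSegment_subset hx hy hxy' hxy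
  rw [interior_closedBall _ one_ne_zero] at this
  simp [hN.norm_eq v hv] at this

theorem dist_le_of_mem_face (hN : IsNet V s ρ κ) {F : Set E3} {d : ℕ} (hd : d < 3)
    (hF : IsFaceDim (convexHull ℝ (V : Set E3)) F d) {A B : E3} (hA : A ∈ V) (hB : B ∈ V)
    (hAF : A ∈ F) (hBF : B ∈ F) (hAB : A ≠ B) : s ≤ dist A B ∧ dist A B ≤ κ * s := by
  obtain ⟨hne, hc, hext, hdim⟩ := hF
  obtain ⟨c, hc1, h, hle, heq⟩ := hext.exists_support (convex_convexHull ℝ _)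
    (interior_convexHull_nonempty_iff_affineSpan_eq_top.2 hN.affineSpan_eq_top) hc hne (by omega)
  exact hN.dist_le_of_support hc1 (fun v hv => hle v (subset_convexHull ℝ _ hv)) hA hB
    (heq A hAF) (heq B hBF) hAB

open Classical in
theorem exists_triangle (hN : IsNet V s ρ κ) {F : Set E3}
    (hF : IsFaceDim (convexHull ℝ (V : Set E3)) F 2) :
    ∃ a b c : E3, a ∈ V ∧ b ∈ V ∧ c ∈ V ∧ AffineIndependent ℝ ![a, b, c] ∧
      F ∩ V = {a, b, c} ∧ F = convexHull ℝ ({a, b, c} : Set E3) := by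
  have hFV := hF.2.2.1.eq_convexHull_inter hF.2.1
  set T : Finset E3 := V.filter (· ∈ F) with hT
  have hTF : (T : Set E3) = F ∩ V := by ext x; simp [hT, and_comm]
  rw [← hTF] at hFV
  have hdim : Module.finrank ℝ (vectorSpan ℝ (T : Set E3)) = 2 := by
    rw [← direction_affineSpan, ← affineSpan_convexHull, ← hFV, direction_affineSpan]
    exact hF.2.2.2
  have hcard3 : T.card ≤ 3 := by
    by_contra hlt
    push Not at hlt
    obtain ⟨U, hUT, hU⟩ := Finset.exists_subset_card_eq (show 4 ≤ T.card from hlt)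
    let p : Fin 4 → E3 := fun i => (U.equivFinOfCardEq hU).symm i
    have hpU : ∀ i, p i ∈ T := fun i => hUT (Subtype.coe_prop _)
    have hinj : ∀ i j, i ≠ j → p i ≠ p j := fun i j hij h =>
      hij ((U.equivFinOfCardEq hU).symm.injective (Subtype.ext h))
    have hs := hN.pos
    have hp : AffineIndependent ℝ p := by
      apply affineIndependent_of_dist_sq_mem_Icc (m := s ^ 2) (M := (κ * s) ^ 2) p
      · rw [mul_pow]
        exact mul_lt_mul_of_pos_right hN.sq_lt (by positivity)
      · intro i j hij
        have h1 := (Finset.mem_filter.1 (hpU i))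
        have h2 := (Finset.mem_filter.1 (hpU j))
        obtain ⟨h3, h4⟩ :=
          hN.dist_le_of_mem_face (by norm_num) hF h1.1 h2.1 h1.2 h2.2 (hinj i j hij)
        constructor <;> gcongr
    have h3 := hp.finrank_vectorSpan (n := 3) (by simp)
    have h4 := Submodule.finrank_mono (vectorSpan_mono ℝ
      (show Set.range p ⊆ (T : Set E3) by rintro _ ⟨i, rfl⟩; exact hpU i))
    omega
  have hcard : T.card = 3 := by
    by_contra hne
    rcases Nat.eq_zero_or_pos T.card with h0 | h0
    · rw [Finset.card_eq_zero] at h0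
      rw [h0, Finset.coe_empty, vectorSpan_empty, finrank_bot] at hdim
      omega
    · have := finrank_vectorSpan_image_finset_le ℝ (id : E3 → E3) T (n := T.card - 1) (by omega)
      rw [Finset.image_id] at this
      omega
  obtain ⟨a, b, c, hab, hac, hbc, habc⟩ := Finset.card_eq_three.1 hcard
  have hmem : ∀ x ∈ ({a, b, c} : Finset E3), x ∈ V := fun x hx =>
    (Finset.mem_filter.1 (habc ▸ hx)).1
  have hset : (T : Set E3) = {a, b, c} := by rw [habc]; simp
  refine ⟨a, b, c, hmem a (by simp), hmem b (by simp), hmem c (by simp), ?_, hTF ▸ hset, hset ▸ hFV⟩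
  rw [affineIndependent_iff_finrank_vectorSpan_eq ℝ _ (n := 2) (by simp)]
  rw [hset] at hdim
  have hr : Set.range ![a, b, c] = {a, b, c} := by
    ext x
    simp [Matrix.range_cons]
    tauto
  rw [hr, hdim]

theorem eta_le (hN : IsNet V s ρ κ) (hκ : 0 ≤ κ) : eta V ≤ κ := by
  have key : ∀ d ∈ edgeLengths V, s ≤ d ∧ d ≤ κ * s := by
    rintro d ⟨p, q, hpq, hF, rfl⟩
    have hFV := hF.2.2.1.eq_convexHull_inter hF.2.1
    have hp := left_mem_segment ℝ p q
    have hq := right_mem_segment ℝ p q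
    have hp' := hp
    have hq' := hq
    rw [hFV] at hp' hq'
    obtain ⟨a, ha, b, hb, hab⟩ := convexHull_exists_dist_ge2 hp' hq'
    have hle : dist a b ≤ dist p q := by
      have h1 := ha.1
      have h2 := hb.1
      rw [segment_eq_image'] at h1 h2
      obtain ⟨x, hx, rfl⟩ := h1
      obtain ⟨y, hy, rfl⟩ := h2
      rw [dist_add_left, dist_eq_norm, ← sub_smul, norm_smul, dist_comm, dist_eq_norm]
      apply mul_le_of_le_one_left (norm_nonneg _)
      rw [Real.norm_eq_abs, abs_le]
      constructor <;> linarith [hx.1, hx.2, hy.1, hy.2]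
    have heq := le_antisymm hab hle
    have hne : a ≠ b := by
      rw [← dist_pos, ← heq]; exact dist_pos.2 hpq
    rw [heq]
    exact hN.dist_le_of_mem_face (by norm_num) hF ha.2 hb.2 ha.1 hb.1 hne
  have hs := hN.pos
  rcases (edgeLengths V).eq_empty_or_nonempty with h0 | hne
  · simp [eta, h0, hκ]
  · have h1 : sSup (edgeLengths V) ≤ κ * s := csSup_le hne fun d hd => (key d hd).2
    have h2 : s ≤ sInf (edgeLengths V) := le_csInf hne fun d hd => (key d hd).1
    rw [eta, div_le_iff₀ (hs.trans_le h2)]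
    exact h1.trans (by gcongr)

end IsNet

namespace IsNet

variable {V : Finset E3} {s ρ κ : ℝ}

theorem exists_face (hN : IsNet V s ρ κ) {A : E3} (hA : A ∈ V) :
    ∃ F, IsFaceDim (convexHull ℝ (V : Set E3)) F 2 ∧ A ∈ F := by
  set K : Set E3 := {n | (∀ v ∈ V, inner ℝ n v ≤ 1) ∧ inner ℝ n A = 1} with hK
  have hKc : IsClosed K := by
    simp only [hK, Set.ofPred_and, Set.ofPred_forall]
    exact (isClosed_biInter fun v _ => isClosed_le (by fun_prop) continuous_const).inter
      (isClosed_eq (by fun_prop) continuous_const)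
  have hKb : K ⊆ Metric.closedBall 0 2 := by
    intro n hn
    rw [mem_closedBall_zero_iff]
    by_contra hlt
    push Not at hlt
    have hnp : 0 < ‖n‖ := by linarith
    have hu : ‖‖n‖⁻¹ • n‖ = 1 := by
      rw [norm_smul, norm_inv, norm_norm, inv_mul_cancel₀ hnp.ne']
    obtain ⟨v, hv, h1⟩ := hN.exists_half_lt_inner hu
    rw [real_inner_smul_left, inv_mul_eq_div, lt_div_iff₀ hnp] at h1
    linarith [hn.1 v hv]
  have hKne : K.Nonempty := by
    refine ⟨A, fun v hv => ?_, ?_⟩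
    · have := real_inner_le_norm A v
      rwa [hN.norm_eq A hA, hN.norm_eq v hv, one_mul] at this
    · rw [real_inner_self_eq_norm_sq, hN.norm_eq A hA]; norm_num
  obtain ⟨n, hn⟩ :=
    ((isCompact_closedBall (0 : E3) 2).of_isClosed_subset hKc hKb).extremePoints_nonempty
    hKne
  have hnK := hn.1
  set F : Set E3 := {x | x ∈ convexHull ℝ (V : Set E3) ∧ inner ℝ n x = 1} with hFdef
  have hPle : ∀ x ∈ convexHull ℝ (V : Set E3), inner ℝ n x ≤ 1 := by
    intro x hx
    have hcv : Convex ℝ {x : E3 | inner ℝ n x ≤ 1} :=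
      convex_halfSpace_le (innerₛₗ ℝ n).isLinear 1
    exact convexHull_min (s := (V : Set E3)) (fun v hv => hnK.1 v hv) hcv hx
  have hAF : A ∈ F := ⟨subset_convexHull ℝ _ hA, hnK.2⟩
  have hspan : Submodule.span ℝ F = ⊤ := by
    rw [← Submodule.orthogonal_eq_bot_iff, Submodule.eq_bot_iff]
    intro d hd
    by_contra hd0
    have hdF : ∀ v ∈ F, inner ℝ d v = 0 := fun v hv => by
      rw [real_inner_comm]
      exact (Submodule.mem_orthogonal _ _).1 hd v (Submodule.subset_span hv)
    have hev : ∀ v ∈ V, ∀ᶠ t : ℝ in nhdsWithin 0 (Set.Ioi 0),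
        inner ℝ (n + t • d) v ≤ 1 ∧ inner ℝ (n - t • d) v ≤ 1 := by
      intro v hv
      by_cases hvF : inner ℝ n v = 1
      · have := hdF v ⟨subset_convexHull ℝ _ hv, hvF⟩
        refine Eventually.of_forall fun t => ?_
        rw [inner_add_left, inner_sub_left, real_inner_smul_left, this, hvF]
        norm_num
      · have hlt := lt_of_le_of_ne (hnK.1 v hv) hvF
        have h1 : Continuous fun t : ℝ => inner ℝ (n + t • d) v := by fun_prop
        have h2 : Continuous fun t : ℝ => inner ℝ (n - t • d) v := by fun_prop
        have h1' := (h1.tendsto 0).eventually_lt_const (u := 1) (by simpa using hlt)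
        have h2' := (h2.tendsto 0).eventually_lt_const (u := 1) (by simpa using hlt)
        exact nhdsWithin_le_nhds ((h1'.and h2').mono fun t ht => ⟨ht.1.le, ht.2.le⟩)
    obtain ⟨t, ht, ht0⟩ :=
      (((Finset.eventually_all V).2 hev).and self_mem_nhdsWithin).exists
    have ht0 : (0 : ℝ) < t := ht0
    have hdA := hdF A hAF
    have m1 : n + t • d ∈ K :=
      ⟨fun v hv => (ht v hv).1, by
        rw [inner_add_left, real_inner_smul_left, hdA, hnK.2]; norm_num⟩
    have m2 : n - t • d ∈ K :=
      ⟨fun v hv => (ht v hv).2, by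
        rw [inner_sub_left, real_inner_smul_left, hdA, hnK.2]; norm_num⟩
    have := hn.2 m1 m2 ⟨1 / 2, 1 / 2, by norm_num, by norm_num, by norm_num, by module⟩
    rw [add_eq_left, smul_eq_zero] at this
    exact this.elim ht0.ne' hd0
  have hn0 : n ≠ 0 := by
    intro h
    have := hnK.2
    simp [h] at this
  refine ⟨F, ⟨⟨A, hAF⟩, ?_, ⟨fun x hx => hx.1, ?_⟩, ?_⟩, hAF⟩
  · exact (convex_convexHull ℝ _).inter (convex_hyperplane (innerₛₗ ℝ n).isLinear 1)
  · rintro x hx y hy z hz ⟨a, b, ha, hb, hab, rfl⟩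
    refine ⟨hx, le_antisymm (hPle x hx) ?_⟩
    have h1 := hz.2
    rw [inner_add_right, real_inner_smul_right, real_inner_smul_right] at h1
    have h2 := hPle y hy
    by_contra hlt
    push Not at hlt
    nlinarith
  · have h1 : Module.finrank ℝ (vectorSpan ℝ F) < 3 := by
      have hne : vectorSpan ℝ F ≠ ⊤ := by
        intro htop
        have hle : vectorSpan ℝ F ≤ (Submodule.span ℝ {n})ᗮ := by
          rw [vectorSpan, Submodule.span_le]
          rintro _ ⟨x, hx, y, hy, rfl⟩
          rw [SetLike.mem_coe, Submodule.mem_orthogonal_singleton_iff_inner_right]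
          simp only [vsub_eq_sub]
          rw [inner_sub_right, hx.2, hy.2, sub_self]
        have hm : n ∈ (Submodule.span ℝ {n})ᗮ := hle (htop ▸ Submodule.mem_top)
        rw [Submodule.mem_orthogonal_singleton_iff_inner_right, inner_self_eq_zero] at hm
        exact hn0 hm
      have := Submodule.finrank_lt hne
      rwa [finrank_euclideanSpace, Fintype.card_fin] at this
    have h2 : Submodule.span ℝ F ≤ vectorSpan ℝ F ⊔ Submodule.span ℝ {A} := by
      rw [Submodule.span_le]
      intro x hx
      rw [← sub_add_cancel x A]
      exact add_mem (Submodule.mem_sup_left (vsub_mem_vectorSpan ℝ hx hAF))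
        (Submodule.mem_sup_right (Submodule.mem_span_singleton_self A))
    have h3 := Submodule.finrank_mono h2
    rw [hspan, finrank_top, finrank_euclideanSpace, Fintype.card_fin] at h3
    have h4 := Submodule.finrank_add_le_finrank_add_finrank (vectorSpan ℝ F) (Submodule.span ℝ {A})
    have h5 := finrank_span_singleton (K := ℝ) (v := A) (by
      rintro rfl
      simpa using hN.norm_eq _ hA)
    omega

open Classical in
theorem exists_inscribedTriPoly (hN : IsNet V s ρ κ) :
    ∃ (m : ℕ) (P : InscribedTriPoly m), P.V = V ∧ V.card ≤ 3 * m := by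
  set S : Set (Set E3) := {F | IsFaceDim (convexHull ℝ (V : Set E3)) F 2} with hS
  have hfin : S.Finite := by
    apply (V.finite_toSet.finite_subsets.image (fun T => convexHull ℝ T)).subset
    intro F hF
    exact ⟨F ∩ V, Set.inter_subset_right, (hF.2.2.1.eq_convexHull_inter hF.2.1).symm⟩
  refine ⟨S.ncard, ⟨V, hN.norm_eq, fun v hv => hN.mem_extremePoints hv, hN.affineSpan_eq_top,
    fun F hF => ?_, rfl⟩, rfl, ?_⟩
  · obtain ⟨a, b, c, ha, hb, hc, hi, -, h⟩ := hN.exists_triangle hF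
    exact ⟨a, b, c, ha, hb, hc, hi, h⟩
  · have hsub : V ⊆ hfin.toFinset.biUnion fun F => V.filter (· ∈ F) := by
      intro v hv
      obtain ⟨F, hF, hvF⟩ := hN.exists_face hv
      simp only [Finset.mem_biUnion, Finset.mem_filter, Set.Finite.mem_toFinset]
      exact ⟨F, hF, hv, hvF⟩
    refine (Finset.card_le_card hsub).trans ?_
    rw [Set.ncard_eq_toFinset_card S hfin, mul_comm]
    apply Finset.card_biUnion_le_card_mul
    intro F hF
    obtain ⟨a, b, c, -, -, -, -, h, -⟩ := hN.exists_triangle ((Set.Finite.mem_toFinset hfin).1 hF)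
    have : V.filter (· ∈ F) = {a, b, c} := by
      ext x
      have := Set.ext_iff.1 h x
      simp only [Set.mem_inter_iff, Finset.mem_coe, Set.mem_insert_iff,
        Set.mem_singleton_iff] at this
      simp [← this, and_comm]
    rw [this]
    exact Finset.card_le_three

end IsNet

/-- The net criterion: nets of arbitrarily large size with ratio at most `κ` bound the liminf. -/
theorem liminf_e_le_of_forall_exists_isNet {κ : ℝ} (hκ : 0 ≤ κ)
    (h : ∀ N : ℕ, ∃ (V : Finset E3) (s ρ : ℝ), IsNet V s ρ κ ∧ N ≤ V.card) :
    Filter.liminf e (Filter.atTop ⊓ Filter.principal {m : ℕ | Nonempty (InscribedTriPoly m)}) ≤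
      κ := by
  have heta : ∀ V, 0 ≤ eta V := fun V =>
    div_nonneg (Real.sSup_nonneg (by rintro _ ⟨p, q, -, -, rfl⟩; exact dist_nonneg))
      (Real.sInf_nonneg (by rintro _ ⟨p, q, -, -, rfl⟩; exact dist_nonneg))
  have hbdd : ∀ m, ∀ x ∈ {x : ℝ | ∃ P : InscribedTriPoly m, x = eta P.V}, 0 ≤ x := by
    rintro m _ ⟨P, rfl⟩
    exact heta _
  apply Filter.liminf_le_of_frequently_le
  · rw [frequently_inf_principal, frequently_atTop]
    intro N
    obtain ⟨V, s, ρ, hN, hcard⟩ := h (3 * N)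
    obtain ⟨m, P, hP, hm⟩ := hN.exists_inscribedTriPoly
    refine ⟨m, by omega, ⟨P⟩, ?_⟩
    refine (csInf_le ⟨0, hbdd m⟩ ⟨P, rfl⟩).trans ?_
    rw [hP]
    exact hN.eta_le hκ
  · exact isBoundedUnder_of ⟨0, fun m => Real.sInf_nonneg (hbdd m)⟩

/-- Dense univariate polynomials, as lists of coefficients in increasing degree. -/
def DensePoly (α : Type*) : Type _ := List α

namespace DensePoly

variable {α : Type*}

def add [Add α] : List α → List α → List α
  | [], q => q
  | p, [] => p
  | a :: p, b :: q => (a + b) :: add p q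

def mul [Zero α] [Add α] [Mul α] : List α → List α → List α
  | [], _ => []
  | a :: p, q => add (q.map (a * ·)) (0 :: mul p q)

instance : Zero (DensePoly α) := ⟨([] : List α)⟩
instance [Add α] : Add (DensePoly α) := ⟨add⟩
instance [Zero α] [Add α] [Mul α] : Mul (DensePoly α) := ⟨mul⟩

/-- Horner evaluation. -/
def eval (ev : α → ℝ) (x : ℝ) : List α → ℝ
  | [] => 0
  | a :: p => ev a + x * eval ev x p

end DensePoly

/-- `ev` respects addition and multiplication. -/
structure IsEval {α : Type*} [Zero α] [Add α] [Mul α] (ev : α → ℝ) : Prop where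
  zero : ev 0 = 0
  add : ∀ a b, ev (a + b) = ev a + ev b
  mul : ∀ a b, ev (a * b) = ev a * ev b

namespace IsEval

variable {α : Type*} [Zero α] [Add α] [Mul α] {ev : α → ℝ}

theorem eval_add (h : IsEval ev) (x : ℝ) :
    ∀ p q : List α, DensePoly.eval ev x (DensePoly.add p q) =
      DensePoly.eval ev x p + DensePoly.eval ev x q
  | [], q => by simp [DensePoly.add, DensePoly.eval]
  | a :: p, [] => by simp [DensePoly.add, DensePoly.eval]
  | a :: p, b :: q => by
    simp only [DensePoly.add, DensePoly.eval, h.add, eval_add h x p q]; ring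

theorem eval_smul (h : IsEval ev) (x : ℝ) (a : α) :
    ∀ q : List α, DensePoly.eval ev x (q.map (a * ·)) = ev a * DensePoly.eval ev x q
  | [] => by simp [DensePoly.eval]
  | b :: q => by
    simp only [List.map_cons, DensePoly.eval, h.mul, eval_smul h x a q]; ring

theorem eval_mul (h : IsEval ev) (x : ℝ) :
    ∀ p q : List α, DensePoly.eval ev x (DensePoly.mul p q) =
      DensePoly.eval ev x p * DensePoly.eval ev x q
  | [], q => by simp [DensePoly.mul, DensePoly.eval]
  | a :: p, q => by
    simp only [DensePoly.mul, DensePoly.eval, h.eval_add, h.eval_smul, eval_mul h x p q, h.zero]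
    ring

theorem densePoly (h : IsEval ev) (x : ℝ) :
    IsEval (α := DensePoly α) (DensePoly.eval ev x) :=
  ⟨rfl, h.eval_add x, h.eval_mul x⟩

end IsEval

theorem DensePoly.eval_nonneg {α : Type*} {ev : α → ℝ} {pos : α → Bool}
    (h : ∀ a, pos a = true → 0 ≤ ev a) {x : ℝ} (hx : 0 ≤ x) :
    ∀ p : List α, p.all pos = true → 0 ≤ DensePoly.eval ev x p
  | [], _ => le_rfl
  | a :: p, hp => by
    rw [List.all_cons, Bool.and_eq_true] at hp
    exact add_nonneg (h a hp.1) (mul_nonneg hx (DensePoly.eval_nonneg h hx p hp.2))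

/-- The pair `(a, b)` stands for `a + b * φ`, where `φ` is the golden ratio. -/
structure GoldenInt where
  re : ℤ
  im : ℤ

namespace GoldenInt

instance : DecidableEq GoldenInt := fun a b =>
  decidable_of_iff (a.re = b.re ∧ a.im = b.im) (by cases a; cases b; simp)

instance : Zero GoldenInt := ⟨⟨0, 0⟩⟩
instance : Add GoldenInt := ⟨fun a b => ⟨a.re + b.re, a.im + b.im⟩⟩
instance : Mul GoldenInt :=
  ⟨fun a b => ⟨a.re * b.re + a.im * b.im, a.re * b.im + a.im * b.re + a.im * b.im⟩⟩

/-- The real number represented by a pair. -/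
def toReal (a : GoldenInt) : ℝ := a.re + a.im * Real.goldenRatio

theorem isEval : IsEval toReal where
  zero := by
    change ((0 : ℤ) : ℝ) + ((0 : ℤ) : ℝ) * Real.goldenRatio = 0
    simp
  add a b := by
    change ((a.re + b.re : ℤ) : ℝ) + ((a.im + b.im : ℤ) : ℝ) * Real.goldenRatio = _
    push_cast [toReal]; ring
  mul a b := by
    change ((a.re * b.re + a.im * b.im : ℤ) : ℝ) +
      ((a.re * b.im + a.im * b.re + a.im * b.im : ℤ) : ℝ) * Real.goldenRatio = _
    push_cast [toReal]
    linear_combination (-(a.im * b.im : ℝ)) * Real.goldenRatio_sq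

theorem goldenRatio_bounds :
    (16180339887 / 10000000000 : ℝ) ≤ Real.goldenRatio ∧
      Real.goldenRatio ≤ (16180339888 / 10000000000 : ℝ) := by
  have h := Real.goldenRatio_sq
  have h1 := Real.one_lt_goldenRatio
  constructor <;> nlinarith

/-- A sufficient test for `0 ≤ a.toReal`. -/
def isPos (a : GoldenInt) : Bool :=
  if 0 ≤ a.im then 0 ≤ a.re * 10000000000 + a.im * 16180339887
  else 0 ≤ a.re * 10000000000 + a.im * 16180339888

theorem toReal_nonneg {a : GoldenInt} (h : a.isPos = true) : 0 ≤ a.toReal := by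
  obtain ⟨h1, h2⟩ := goldenRatio_bounds
  unfold isPos at h
  unfold toReal
  split_ifs at h with h0
  · have h' : (0 : ℝ) ≤ a.re * 10000000000 + a.im * 16180339887 := by
      exact_mod_cast of_decide_eq_true h
    have h0' : (0 : ℝ) ≤ a.im := by exact_mod_cast h0
    nlinarith
  · have h' : (0 : ℝ) ≤ a.re * 10000000000 + a.im * 16180339888 := by
      exact_mod_cast of_decide_eq_true h
    have h0' : (a.im : ℝ) ≤ 0 := by
      push Not at h0
      exact_mod_cast h0.le
    nlinarith

end GoldenInt

/-- Polynomials in two variables with coefficients in `ℤ[φ]`. -/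
abbrev GoldenPoly : Type := DensePoly (DensePoly GoldenInt)

namespace GoldenPoly

def eval (x y : ℝ) : GoldenPoly → ℝ :=
  DensePoly.eval (DensePoly.eval GoldenInt.toReal y) x

theorem isEval (x y : ℝ) : IsEval (eval x y) := (GoldenInt.isEval.densePoly y).densePoly x

def isPos (p : GoldenPoly) : Bool :=
  List.all p fun q : DensePoly GoldenInt => List.all q GoldenInt.isPos

theorem eval_nonneg {x y : ℝ} (hx : 0 ≤ x) (hy : 0 ≤ y) {p : GoldenPoly}
    (h : p.isPos = true) : 0 ≤ eval x y p :=
  DensePoly.eval_nonneg (fun q => DensePoly.eval_nonneg (fun _ => GoldenInt.toReal_nonneg) hy q)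
    hx p h

/-- The constant `a + b * φ`. -/
def C (a b : ℤ) : GoldenPoly :=
  ([([⟨a, b⟩] : List GoldenInt)] : List (DensePoly GoldenInt))

def X : GoldenPoly := ([0, ([⟨1, 0⟩] : List GoldenInt)] : List (DensePoly GoldenInt))

def Y : GoldenPoly := ([([0, ⟨1, 0⟩] : List GoldenInt)] : List (DensePoly GoldenInt))

theorem eval_C (x y : ℝ) (a b : ℤ) : eval x y (C a b) = a + b * Real.goldenRatio := by
  simp [eval, C, DensePoly.eval, GoldenInt.toReal]

theorem eval_X (x y : ℝ) : eval x y X = x := by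
  simp [eval, X, DensePoly.eval, GoldenInt.toReal]

theorem eval_Y (x y : ℝ) : eval x y Y = y := by
  simp [eval, Y, DensePoly.eval, GoldenInt.isEval.zero]
  simp [GoldenInt.toReal]

/-- Homogenization by `S` of the radial coordinate function. -/
def g (S T : GoldenPoly) : GoldenPoly :=
  T * (C 4320 0 * (S * S * S) + C 13648 (-9216) * (S * S * T) + C (-14263) 9216 * (S * T * T) +
    C (-195) 0 * (T * T * T))

/-- Homogenization by `S` of the derivative of the radial coordinate function. -/
def g' (S T : GoldenPoly) : GoldenPoly :=
  C 4320 0 * (S * S * S) + C 27296 (-18432) * (S * S * T) + C (-42789) 27648 * (S * T * T) +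
    C (-780) 0 * (T * T * T)

/-- The polynomials bounding the stretch of edges from below and above, with `z = 1`. -/
def lowerUpper : GoldenPoly × GoldenPoly :=
  let S := X + Y + C 1 0
  let a := g S X
  let b := g S Y
  let c := g S (C 1 0)
  let a' := g' S X
  let b' := g' S Y
  let ww := C 2 0 * (a * a + b * b + c * c) + C 0 1 * ((a + b + c) * (a + b + c))
  let d := a' + C (-1) 0 * b'
  let i := C 2 0 * (a * a' + C (-1) 0 * (b * b')) + C 0 1 * ((a + b + c) * d)
  let area := S * S * (ww * (C 2 0 * (a' * a' + b' * b') + C 0 1 * (d * d)) + C (-1) 0 * (i * i))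
  (C 845 0 * area + C (-1024) 0 * (ww * ww), C 3072 (-1024) * (ww * ww) + C (-845) 0 * area)

theorem isPos_lowerUpper : (lowerUpper.1.isPos && lowerUpper.2.isPos) = true := by
  decide +kernel

end GoldenPoly

section

open Real

def gHom (S T : ℝ) : ℝ :=
  T * (4320 * S ^ 3 + (13648 - 9216 * goldenRatio) * S ^ 2 * T +
    (-14263 + 9216 * goldenRatio) * S * T ^ 2 - 195 * T ^ 3)

def gHom' (S T : ℝ) : ℝ :=
  4320 * S ^ 3 + (27296 - 18432 * goldenRatio) * S ^ 2 * T +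
    (-42789 + 27648 * goldenRatio) * S * T ^ 2 - 780 * T ^ 3

/-- `‖a p₁ + b p₂ + c p₃‖²` for adjacent icosahedron vertices. -/
def normForm (a b c : ℝ) : ℝ := 2 * (a ^ 2 + b ^ 2 + c ^ 2) + goldenRatio * (a + b + c) ^ 2

/-- The Gram determinant of `a p₁ + b p₂ + c p₃` and `a' p₁ - b' p₂`. -/
def gramForm (a b c a' b' : ℝ) : ℝ :=
  normForm a b c * normForm a' (-b') 0 -
    (2 * (a * a' - b * b') + goldenRatio * ((a + b + c) * (a' - b'))) ^ 2

def lowerForm (S x y z : ℝ) : ℝ :=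
  845 * (S ^ 2 * gramForm (gHom S x) (gHom S y) (gHom S z) (gHom' S x) (gHom' S y)) -
    1024 * normForm (gHom S x) (gHom S y) (gHom S z) ^ 2

def upperForm (S x y z : ℝ) : ℝ :=
  1024 * (3 - goldenRatio) * normForm (gHom S x) (gHom S y) (gHom S z) ^ 2 -
    845 * (S ^ 2 * gramForm (gHom S x) (gHom S y) (gHom S z) (gHom' S x) (gHom' S y))

theorem GoldenPoly.eval_g (x y : ℝ) (S T : GoldenPoly) :
    eval x y (g S T) = gHom (eval x y S) (eval x y T) := by
  have hE := isEval x y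
  simp only [g, hE.add, hE.mul, eval_C, gHom]
  push_cast
  ring

theorem GoldenPoly.eval_g' (x y : ℝ) (S T : GoldenPoly) :
    eval x y (g' S T) = gHom' (eval x y S) (eval x y T) := by
  have hE := isEval x y
  simp only [g', hE.add, hE.mul, eval_C, gHom']
  push_cast
  ring

theorem forms_nonneg_one {x y : ℝ} (hx : 0 ≤ x) (hy : 0 ≤ y) :
    0 ≤ lowerForm (x + y + 1) x y 1 ∧ 0 ≤ upperForm (x + y + 1) x y 1 := by
  have h := GoldenPoly.isPos_lowerUpper
  rw [Bool.and_eq_true] at h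
  have h1 := GoldenPoly.eval_nonneg hx hy h.1
  have h2 := GoldenPoly.eval_nonneg hx hy h.2
  have hE := GoldenPoly.isEval x y
  simp only [GoldenPoly.lowerUpper, GoldenPoly.eval_g, GoldenPoly.eval_g', hE.add, hE.mul,
    GoldenPoly.eval_C, GoldenPoly.eval_X, GoldenPoly.eval_Y, Int.cast_one, Int.cast_zero,
    zero_mul, add_zero] at h1 h2
  constructor
  · convert h1 using 1
    simp only [lowerForm, gramForm, normForm]
    push_cast
    ring
  · convert h2 using 1
    simp only [upperForm, gramForm, normForm]
    push_cast
    ring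

theorem forms_div (S x y z t : ℝ) :
    lowerForm (S / t) (x / t) (y / t) (z / t) = lowerForm S x y z / t ^ 16 ∧
    upperForm (S / t) (x / t) (y / t) (z / t) = upperForm S x y z / t ^ 16 := by
  have hg : ∀ T, gHom (S / t) (T / t) = gHom S T / t ^ 4 := fun T => by unfold gHom; ring
  have hg' : ∀ T, gHom' (S / t) (T / t) = gHom' S T / t ^ 3 := fun T => by unfold gHom'; ring
  simp only [lowerForm, upperForm, gramForm, normForm, hg, hg']
  constructor <;> ring

theorem forms_nonneg {x y z : ℝ} (hx : 0 ≤ x) (hy : 0 ≤ y) (hz : 0 ≤ z) :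
    0 ≤ lowerForm (x + y + z) x y z ∧ 0 ≤ upperForm (x + y + z) x y z := by
  have hpos : ∀ z > 0, 0 ≤ lowerForm (x + y + z) x y z ∧ 0 ≤ upperForm (x + y + z) x y z := by
    intro z hz
    have h := forms_nonneg_one (div_nonneg hx hz.le) (div_nonneg hy hz.le)
    obtain ⟨h1, h2⟩ := forms_div (x + y + z) x y z z
    rw [div_self hz.ne', add_div, add_div, div_self hz.ne'] at h1 h2
    rw [h1, h2] at h
    have hz16 : 0 < z ^ 16 := by positivity
    exact ⟨by simpa using (le_div_iff₀ hz16).1 h.1, by simpa using (le_div_iff₀ hz16).1 h.2⟩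
  rcases hz.eq_or_lt with rfl | hz
  · have c1 : Continuous fun z => lowerForm (x + y + z) x y z := by
      simp only [lowerForm, gramForm, normForm, gHom, gHom']; fun_prop
    have c2 : Continuous fun z => upperForm (x + y + z) x y z := by
      simp only [upperForm, gramForm, normForm, gHom, gHom']; fun_prop
    have l1 := (c1.tendsto 0).mono_left (nhdsWithin_le_nhds (s := Set.Ioi 0))
    have l2 := (c2.tendsto 0).mono_left (nhdsWithin_le_nhds (s := Set.Ioi 0))
    exact ⟨ge_of_tendsto l1 (eventually_mem_nhdsWithin.mono fun z hz => (hpos z hz).1),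
      ge_of_tendsto l2 (eventually_mem_nhdsWithin.mono fun z hz => (hpos z hz).2)⟩
  · exact hpos z hz

/-- Coordinates of the twelve vertices `(0, ±1, ±φ)` (up to cyclic permutation) of the regular
icosahedron. -/
def icoCoord (i : Fin 12) (c : Fin 3) : GoldenInt :=
  if (c.val + i.val / 4) % 3 = 0 then ⟨0, 0⟩
  else if (c.val + i.val / 4) % 3 = 1 then ⟨if i.val % 2 = 0 then 1 else -1, 0⟩
  else ⟨0, if i.val / 2 % 2 = 0 then 1 else -1⟩

def icoDot (i j : Fin 12) : GoldenInt :=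
  icoCoord i 0 * icoCoord j 0 + icoCoord i 1 * icoCoord j 1 + icoCoord i 2 * icoCoord j 2

/-- A vertex of the regular icosahedron. -/
def ico (i : Fin 12) : E3 := WithLp.toLp 2 fun c => (icoCoord i c).toReal

theorem inner_ico (i j : Fin 12) : inner ℝ (ico i) (ico j) = (icoDot i j).toReal := by
  have hE := GoldenInt.isEval
  simp only [icoDot, hE.add, hE.mul, ico, PiLp.inner_apply, Fin.sum_univ_three]
  simp [mul_comm]

/-- `t` lists the vertices of a face of the icosahedron. -/
def IsTri (t : Fin 3 → Fin 12) : Prop := ∀ a b, a ≠ b → icoDot (t a) (t b) = ⟨0, 1⟩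

/-- `i` and `i'` are opposite across an edge. -/
def IsOpp (i i' : Fin 12) : Prop := icoDot i i' = ⟨0, -1⟩

instance (t : Fin 3 → Fin 12) : Decidable (IsTri t) := by unfold IsTri; infer_instance
instance (i i' : Fin 12) : Decidable (IsOpp i i') := by unfold IsOpp; infer_instance

theorem exists_isTri : ∃ t, IsTri t := ⟨![0, 4, 8], by decide +kernel⟩

theorem icoDot_self : ∀ i, icoDot i i = ⟨2, 1⟩ := by decide +kernel

theorem icoDot_of_ne : ∀ i j, i ≠ j →
    icoDot i j = ⟨0, 1⟩ ∨ icoDot i j = ⟨0, -1⟩ ∨ icoDot i j = ⟨-2, -1⟩ := by decide +kernel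

theorem exists_opp_aux : ∀ i j k, icoDot i j = ⟨0, 1⟩ → icoDot i k = ⟨0, 1⟩ →
    icoDot j k = ⟨0, 1⟩ →
    ∃ i', icoDot j i' = ⟨0, 1⟩ ∧ icoDot k i' = ⟨0, 1⟩ ∧ IsOpp i i' := by decide +kernel

theorem exists_reflect_aux : ∀ i i', IsOpp i i' → ∀ l, ∃ l', ∀ c,
    (⟨2, 2⟩ : GoldenInt) * icoCoord l' c +
      (icoDot l i + ⟨-1, 0⟩ * icoDot l i') * (icoCoord i c + ⟨-1, 0⟩ * icoCoord i' c) =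
      ⟨2, 2⟩ * icoCoord l c := by decide +kernel

theorem icoDot_comm : ∀ i j, icoDot i j = icoDot j i := by decide +kernel

theorem inner_ico_self (i : Fin 12) : inner ℝ (ico i) (ico i) = 2 + goldenRatio := by
  rw [inner_ico, icoDot_self]; simp [GoldenInt.toReal]

theorem inner_ico_of_adj {i j : Fin 12} (h : icoDot i j = ⟨0, 1⟩) :
    inner ℝ (ico i) (ico j) = goldenRatio := by
  rw [inner_ico, h]; simp [GoldenInt.toReal]

theorem inner_ico_of_isOpp {i j : Fin 12} (h : IsOpp i j) :
    inner ℝ (ico i) (ico j) = -goldenRatio := by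
  rw [inner_ico, h]; simp [GoldenInt.toReal]

theorem inner_ico_le {i j : Fin 12} (h : i ≠ j) : inner ℝ (ico i) (ico j) ≤ goldenRatio := by
  have := goldenRatio_pos
  rw [inner_ico]
  rcases icoDot_of_ne i j h with h | h | h <;> rw [h] <;> simp only [GoldenInt.toReal] <;>
    push_cast <;> linarith

theorem icoDot_eq_of_inner_eq {i j : Fin 12} (h : inner ℝ (ico i) (ico j) = goldenRatio) :
    icoDot i j = ⟨0, 1⟩ := by
  have hφ := goldenRatio_pos
  by_cases hij : i = j
  · rw [hij, inner_ico_self] at h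
    linarith
  · rw [inner_ico] at h
    rcases icoDot_of_ne i j hij with h' | h' | h'
    · exact h'
    · rw [h'] at h; simp only [GoldenInt.toReal] at h; push_cast at h; linarith
    · rw [h'] at h; simp only [GoldenInt.toReal] at h; push_cast at h; linarith

/-- The combination of the vertices of `t` with coefficients `α`. -/
def lin (t : Fin 3 → Fin 12) (α : Fin 3 → ℝ) : E3 := ∑ i, α i • ico (t i)

namespace IsTri

variable {t : Fin 3 → Fin 12}

theorem injective (ht : IsTri t) : Function.Injective t := by
  intro a b hab
  by_contra hne
  have := ht a b hne
  rw [hab, icoDot_self] at this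
  exact absurd this (by decide)

theorem inner_eq (ht : IsTri t) (a b : Fin 3) :
    inner ℝ (ico (t a)) (ico (t b)) = (if a = b then 2 else 0) + goldenRatio := by
  split_ifs with h
  · rw [h, inner_ico_self]
  · rw [inner_ico_of_adj (ht a b h), zero_add]

theorem inner_lin_ico (ht : IsTri t) (α : Fin 3 → ℝ) (a : Fin 3) :
    inner ℝ (lin t α) (ico (t a)) = 2 * α a + goldenRatio * ∑ i, α i := by
  simp only [lin, sum_inner, real_inner_smul_left, ht.inner_eq, mul_add, Finset.sum_add_distrib,
    Finset.mul_sum]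
  simp [mul_comm]

theorem inner_lin_lin (ht : IsTri t) (α β : Fin 3 → ℝ) :
    inner ℝ (lin t α) (lin t β) =
      2 * ∑ i, α i * β i + goldenRatio * ((∑ i, α i) * ∑ i, β i) := by
  rw [show lin t β = ∑ i, β i • ico (t i) from rfl]
  simp only [inner_sum, real_inner_smul_right, ht.inner_lin_ico]
  simp only [Fin.sum_univ_three]
  ring

theorem norm_lin_sq (ht : IsTri t) (α : Fin 3 → ℝ) :
    ‖lin t α‖ ^ 2 = normForm (α 0) (α 1) (α 2) := by
  rw [← real_inner_self_eq_norm_sq, ht.inner_lin_lin, normForm]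
  simp only [Fin.sum_univ_three]
  ring

end IsTri

theorem lin_add (t : Fin 3 → Fin 12) (α β : Fin 3 → ℝ) :
    lin t (α + β) = lin t α + lin t β := by
  simp [lin, add_smul, Finset.sum_add_distrib]

theorem lin_sub (t : Fin 3 → Fin 12) (α β : Fin 3 → ℝ) :
    lin t (α - β) = lin t α - lin t β := by
  simp [lin, sub_smul, Finset.sum_sub_distrib]

theorem lin_smul (t : Fin 3 → Fin 12) (r : ℝ) (α : Fin 3 → ℝ) :
    lin t (r • α) = r • lin t α := by
  simp [lin, mul_smul, Finset.smul_sum]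

namespace IsTri

variable {t : Fin 3 → Fin 12}

theorem lin_eq_zero (ht : IsTri t) {α : Fin 3 → ℝ} (h : lin t α = 0) : α = 0 := by
  have h1 := ht.norm_lin_sq α
  rw [h, norm_zero, normForm] at h1
  have hφ := goldenRatio_pos
  have h2 : 0 ≤ goldenRatio * (α 0 + α 1 + α 2) ^ 2 := by positivity
  have h3 := sq_nonneg (α 0)
  have h4 := sq_nonneg (α 1)
  have h5 := sq_nonneg (α 2)
  funext i
  have : α i ^ 2 = 0 := by
    fin_cases i <;> simp only [Fin.zero_eta, Fin.mk_one, Fin.reduceFinMk] <;> linarith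
  simpa using this

theorem lin_injective (ht : IsTri t) : Function.Injective (lin t) := by
  intro α β h
  rw [← sub_eq_zero, ← lin_sub] at h
  exact sub_eq_zero.1 (ht.lin_eq_zero h)

theorem lin_surjective (ht : IsTri t) : Function.Surjective (lin t) := by
  let L : (Fin 3 → ℝ) →ₗ[ℝ] E3 :=
    { toFun := lin t, map_add' := lin_add t, map_smul' := lin_smul t }
  exact (LinearMap.injective_iff_surjective_of_finrank_eq_finrank (f := L) (by simp)).1
    ht.lin_injective

theorem exists_opp (ht : IsTri t) (a : Fin 3) :
    ∃ i', IsOpp (t a) i' ∧ ∀ b, b ≠ a → icoDot (t b) i' = ⟨0, 1⟩ := by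
  have cases_ne : ∀ a b : Fin 3, b ≠ a → b = a + 1 ∨ b = a + 2 := by decide
  obtain ⟨i', h1, h2, h3⟩ := exists_opp_aux (t a) (t (a + 1)) (t (a + 2))
    (ht _ _ (by revert a; decide)) (ht _ _ (by revert a; decide)) (ht _ _ (by revert a; decide))
  refine ⟨i', h3, fun b hb => ?_⟩
  rcases cases_ne a b hb with h | h
  · rwa [h]
  · rwa [h]

theorem update (ht : IsTri t) {a : Fin 3} {i' : Fin 12}
    (h : ∀ b, b ≠ a → icoDot (t b) i' = ⟨0, 1⟩) : IsTri (Function.update t a i') := by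
  intro b c hbc
  by_cases hb : b = a
  · subst hb
    rw [Function.update_self, Function.update_of_ne hbc.symm, icoDot_comm, h c hbc.symm]
  · rw [Function.update_of_ne hb]
    by_cases hc : c = a
    · subst hc
      rw [Function.update_self, h b hb]
    · rw [Function.update_of_ne hc, ht b c hbc]

theorem inner_lin_sub (ht : IsTri t) {a : Fin 3} {i' : Fin 12} (ho : IsOpp (t a) i')
    (h : ∀ b, b ≠ a → icoDot (t b) i' = ⟨0, 1⟩) (α : Fin 3 → ℝ) :
    inner ℝ (lin t α) (ico (t a) - ico i') = α a * (2 * goldenRatio ^ 2) := by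
  have key : ∀ b, inner ℝ (ico (t b)) (ico (t a) - ico i') =
      if b = a then 2 * goldenRatio ^ 2 else 0 := by
    intro b
    rw [inner_sub_right, ht.inner_eq]
    split_ifs with hb
    · rw [hb, inner_ico_of_isOpp ho, goldenRatio_sq]; ring
    · rw [inner_ico_of_adj (h b hb)]; ring
  simp only [lin, sum_inner, real_inner_smul_left, key]
  simp

/-- Every vector lies in the cone over some face. -/
theorem _root_.exists_lin_nonneg (c : E3) :
    ∃ t, IsTri t ∧ ∃ α : Fin 3 → ℝ, (∀ i, 0 ≤ α i) ∧ lin t α = c := by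
  obtain ⟨t, ht, hmax⟩ := (Finset.univ.filter IsTri).exists_max_image
    (fun t => inner ℝ c (∑ i, ico (t i))) (by
      obtain ⟨t, ht⟩ := exists_isTri
      exact ⟨t, by simpa using ht⟩)
  rw [Finset.mem_filter] at ht
  have ht := ht.2
  obtain ⟨α, rfl⟩ := ht.lin_surjective c
  refine ⟨t, ht, α, fun a => ?_, rfl⟩
  obtain ⟨i', ho, h⟩ := ht.exists_opp a
  have h1 := hmax (Function.update t a i') (by simpa using ht.update h)
  have h2 := ht.inner_lin_sub ho h α
  have h3 : ∑ i, ico (Function.update t a i' i) = ∑ i, ico (t i) - (ico (t a) - ico i') := by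
    rw [← Finset.add_sum_erase _ _ (Finset.mem_univ a),
      ← Finset.add_sum_erase _ (fun i => ico (t i)) (Finset.mem_univ a), Function.update_self]
    rw [Finset.sum_congr rfl fun i hi => by
      rw [Function.update_of_ne (Finset.ne_of_mem_erase hi)]]
    abel
  rw [h3, inner_sub_right, h2] at h1
  have hφ := goldenRatio_pos
  by_contra hneg
  push Not at hneg
  have : α a * (2 * goldenRatio ^ 2) < 0 := mul_neg_of_neg_of_pos hneg (by positivity)
  linarith

/-- Two nonnegative combinations over faces agree only if they are supported on common vertices. -/
theorem eq_zero_of_lin_eq (ht : IsTri t) {t' : Fin 3 → Fin 12} (ht' : IsTri t')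
    {α β : Fin 3 → ℝ} (hα : ∀ i, 0 ≤ α i) (hβ : ∀ i, 0 ≤ β i) (h : lin t α = lin t' β)
    {j : Fin 3} (hj : t' j ∉ Set.range t) : β j = 0 := by
  have hφ := goldenRatio_pos
  have self : ∀ {t : Fin 3 → Fin 12} {α : Fin 3 → ℝ}, IsTri t →
      inner ℝ (lin t α) (lin t 1) = (2 + 3 * goldenRatio) * ∑ i, α i := by
    intro t α ht
    rw [ht.inner_lin_lin]; simp; ring
  have single : ∀ {t : Fin 3 → Fin 12}, IsTri t → ∀ v, 
      inner ℝ (ico v) (lin t 1) ≤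
        if v ∈ Set.range t then 2 + 3 * goldenRatio else 3 * goldenRatio := by
    intro t ht v
    split_ifs with hv
    · obtain ⟨a, rfl⟩ := hv
      rw [real_inner_comm, ht.inner_lin_ico]; simp; linarith
    · have : ∀ i, inner ℝ (ico v) (ico (t i)) ≤ goldenRatio := fun i =>
        inner_ico_le fun h => hv ⟨i, h.symm⟩
      simp only [lin, inner_sum, Pi.one_apply, one_smul]
      rw [Fin.sum_univ_three]
      linarith [this 0, this 1, this 2]
  have cross : ∀ {t t' : Fin 3 → Fin 12} {β : Fin 3 → ℝ}, IsTri t → (∀ i, 0 ≤ β i) →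
      inner ℝ (lin t' β) (lin t 1) ≤ (2 + 3 * goldenRatio) * ∑ i, β i := by
    intro t t' β ht hβ
    rw [show lin t' β = ∑ i, β i • ico (t' i) from rfl]
    simp only [sum_inner, real_inner_smul_left, Finset.mul_sum]
    refine Finset.sum_le_sum fun i _ => ?_
    rw [mul_comm]
    refine mul_le_mul_of_nonneg_right ((single ht _).trans ?_) (hβ i)
    split_ifs <;> linarith
  have e1 := self (α := β) ht'
  have e2 := cross (t := t') (t' := t) ht' hα
  have e3 : inner ℝ (lin t' β) (lin t 1) ≤ (2 + 3 * goldenRatio) * ∑ i, β i - 2 * β j := by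
    rw [show lin t' β = ∑ i, β i • ico (t' i) from rfl]
    simp only [sum_inner, real_inner_smul_left]
    rw [← Finset.add_sum_erase _ _ (Finset.mem_univ j),
      ← Finset.add_sum_erase _ β (Finset.mem_univ j), mul_add, Finset.mul_sum]
    have s1 := single ht (t' j)
    rw [if_neg hj] at s1
    have s2 := mul_le_mul_of_nonneg_left s1 (hβ j)
    have s3 : ∑ i ∈ Finset.univ.erase j, β i * inner ℝ (ico (t' i)) (lin t 1) ≤
        ∑ i ∈ Finset.univ.erase j, (2 + 3 * goldenRatio) * β i := by
      refine Finset.sum_le_sum fun i _ => ?_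
      rw [mul_comm]
      refine mul_le_mul_of_nonneg_right ((single ht _).trans ?_) (hβ i)
      split_ifs <;> linarith
    linarith
  have e4 := self (α := α) ht
  rw [← h] at e1 e3
  have := hβ j
  nlinarith

end IsTri

/-- The reflection exchanging the opposite vertices `i` and `i'`. -/
def reflect (i i' : Fin 12) (x : E3) : E3 :=
  x - (inner ℝ x (ico i - ico i') / (2 * goldenRatio ^ 2)) • (ico i - ico i')

namespace IsOpp

variable {i i' : Fin 12}

theorem inner_self (h : IsOpp i i') :
    inner ℝ (ico i - ico i') (ico i - ico i') = 4 * goldenRatio ^ 2 := by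
  rw [inner_sub_left, inner_sub_right, inner_sub_right, real_inner_comm (ico i) (ico i'),
    inner_ico_self, inner_ico_self, inner_ico_of_isOpp h, goldenRatio_sq]
  ring

theorem inner_reflect (h : IsOpp i i') (x : E3) :
    inner ℝ (reflect i i' x) (ico i - ico i') = -inner ℝ x (ico i - ico i') := by
  have hφ := goldenRatio_pos
  rw [reflect, inner_sub_left, real_inner_smul_left, h.inner_self]
  field_simp
  ring

theorem norm_reflect (h : IsOpp i i') (x : E3) : ‖reflect i i' x‖ = ‖x‖ := by
  have hφ := goldenRatio_pos
  rw [← sq_eq_sq₀ (norm_nonneg _) (norm_nonneg _), ← real_inner_self_eq_norm_sq,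
    ← real_inner_self_eq_norm_sq]
  nth_rw 2 [reflect]
  rw [inner_sub_right, real_inner_smul_right, h.inner_reflect, reflect, inner_sub_left,
    real_inner_smul_left, real_inner_comm x (ico i - ico i')]
  ring

theorem dist_sq (h : IsOpp i i') (x y : E3) :
    dist x y ^ 2 = dist x (reflect i i' y) ^ 2 -
      2 * inner ℝ x (ico i - ico i') * inner ℝ y (ico i - ico i') / (2 * goldenRatio ^ 2) := by
  have hφ := goldenRatio_pos
  rw [dist_eq_norm, dist_eq_norm, norm_sub_sq_real, norm_sub_sq_real, h.norm_reflect, reflect,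
    inner_sub_right, real_inner_smul_right]
  ring

theorem exists_reflect_ico (h : IsOpp i i') (l : Fin 12) :
    ∃ l', reflect i i' (ico l) = ico l' := by
  obtain ⟨l', hl'⟩ := exists_reflect_aux i i' h l
  refine ⟨l', ?_⟩
  have hE := GoldenInt.isEval
  have hφ := goldenRatio_pos
  ext c
  have coord : ∀ l, ico l c = (icoCoord l c).toReal := fun _ => rfl
  have key := congrArg GoldenInt.toReal (hl' c)
  simp only [hE.add, hE.mul, ← inner_ico, ← coord] at key
  have h2 : GoldenInt.toReal ⟨2, 2⟩ = 2 * goldenRatio ^ 2 := by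
    rw [goldenRatio_sq, GoldenInt.toReal]; push_cast; ring
  have h1 : GoldenInt.toReal ⟨-1, 0⟩ = -1 := by simp [GoldenInt.toReal]
  rw [h2, h1] at key
  have hpos : 0 < 2 * goldenRatio ^ 2 := by positivity
  simp only [reflect, inner_sub_right, PiLp.sub_apply, PiLp.smul_apply, smul_eq_mul]
  generalize 2 * goldenRatio ^ 2 = K at key hpos ⊢
  field_simp
  linear_combination -key

end IsOpp

/-- The profile applied to barycentric coordinates before projecting to the sphere. -/
def warp (x : ℝ) : ℝ := gHom 1 x

/-- The divided difference of `warp`. -/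
def slope₂ (x y : ℝ) : ℝ :=
  4320 + (13648 - 9216 * goldenRatio) * (x + y) +
    (-14263 + 9216 * goldenRatio) * (x ^ 2 + x * y + y ^ 2) -
    195 * (x ^ 3 + x ^ 2 * y + x * y ^ 2 + y ^ 3)

theorem warp_sub_warp (x y : ℝ) : warp y - warp x = (y - x) * slope₂ x y := by
  unfold warp gHom slope₂; ring

theorem slope₂_self (x : ℝ) : slope₂ x x = gHom' 1 x := by
  unfold slope₂ gHom'; ring

theorem warp_zero : warp 0 = 0 := by simp [warp, gHom]

theorem goldenRatio_near : 1.618 < goldenRatio ∧ goldenRatio < 1.6181 := by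
  have h1 := goldenRatio_sq
  have h2 := goldenRatio_pos
  constructor <;> nlinarith

theorem slope₂_pos {x y : ℝ} (hx : 0 ≤ x) (hx1 : x ≤ 1) (hy : 0 ≤ y) (hy1 : y ≤ 1) :
    0 < slope₂ x y := by
  obtain ⟨h1, h2⟩ := goldenRatio_near
  unfold slope₂
  generalize goldenRatio = p at *
  have a1 : x ^ 2 ≤ 1 := pow_le_one₀ hx hx1
  have a2 : y ^ 2 ≤ 1 := pow_le_one₀ hy hy1
  have b1 : x ^ 3 ≤ 1 := pow_le_one₀ hx hx1
  have b2 : y ^ 3 ≤ 1 := pow_le_one₀ hy hy1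
  have b3 : x ^ 2 * y ≤ 1 := mul_le_one₀ a1 hy hy1
  have b4 : x * y ^ 2 ≤ 1 := mul_le_one₀ hx1 (sq_nonneg y) a2
  have c1 : 0 ≤ (-14263 + 9216 * p) * (x ^ 2 + x * y + y ^ 2) :=
    mul_nonneg (by linarith) (by positivity)
  have c2 : (9216 * p - 13648) * (x + y) ≤ 1300 * 2 :=
    mul_le_mul (by linarith) (by linarith) (by linarith) (by linarith)
  linarith

theorem warp_strictMonoOn : StrictMonoOn warp (Set.Icc 0 1) := by
  intro x hx y hy hxy
  have := mul_pos (sub_pos.2 hxy) (slope₂_pos hx.1 hx.2 hy.1 hy.2)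
  rw [← warp_sub_warp] at this
  linarith

theorem warp_pos {x : ℝ} (hx : 0 < x) (hx1 : x ≤ 1) : 0 < warp x := by
  have := warp_strictMonoOn (a := 0) (b := x) ⟨le_rfl, zero_le_one⟩ ⟨hx.le, hx1⟩ hx
  rwa [warp_zero] at this

theorem warp_nonneg {x : ℝ} (hx : 0 ≤ x) (hx1 : x ≤ 1) : 0 ≤ warp x := by
  rcases hx.eq_or_lt with rfl | hx
  · exact warp_zero.ge
  · exact (warp_pos hx hx1).le

/-- The standard triangle. -/
def simplex₃ : Set (Fin 3 → ℝ) := {x | (∀ i, 0 ≤ x i) ∧ ∑ i, x i = 1}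

theorem simplex₃_le_one {x : Fin 3 → ℝ} (hx : x ∈ simplex₃) (i : Fin 3) : x i ≤ 1 :=
  hx.2 ▸ Finset.single_le_sum (fun j _ => hx.1 j) (Finset.mem_univ i)

/-- The point of the sphere with warped barycentric coordinates `x` over the face `t`. -/
def pt (t : Fin 3 → Fin 12) (x : Fin 3 → ℝ) : E3 :=
  ‖lin t (warp ∘ x)‖⁻¹ • lin t (warp ∘ x)

theorem warp_comp_nonneg {x : Fin 3 → ℝ} (hx : x ∈ simplex₃) (i : Fin 3) : 0 ≤ (warp ∘ x) i :=
  warp_nonneg (hx.1 i) (simplex₃_le_one hx i)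

theorem warp_comp_ne_zero {x : Fin 3 → ℝ} (hx : x ∈ simplex₃) : warp ∘ x ≠ 0 := by
  intro h
  have h0 : ∀ i, x i = 0 := by
    intro i
    by_contra hne
    exact (warp_pos (lt_of_le_of_ne (hx.1 i) (Ne.symm hne)) (simplex₃_le_one hx i)).ne'
      (congrFun h i)
  have := hx.2
  simp [h0] at this

theorem IsTri.norm_lin_pos {t : Fin 3 → Fin 12} (ht : IsTri t) {x : Fin 3 → ℝ}
    (hx : x ∈ simplex₃) : 0 < ‖lin t (warp ∘ x)‖ :=
  norm_pos_iff.2 fun h => warp_comp_ne_zero hx (ht.lin_eq_zero h)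

theorem IsTri.norm_pt {t : Fin 3 → Fin 12} (ht : IsTri t) {x : Fin 3 → ℝ}
    (hx : x ∈ simplex₃) : ‖pt t x‖ = 1 := by
  rw [pt, norm_smul, norm_inv, norm_norm, inv_mul_cancel₀ (ht.norm_lin_pos hx).ne']

/-- The point of the simplex with barycentric coordinates `a / n`. -/
def grid (n : ℕ) (a : Fin 3 → ℕ) (i : Fin 3) : ℝ := a i / n

theorem grid_mem {n : ℕ} (hn : 0 < n) {a : Fin 3 → ℕ} (ha : ∑ i, a i = n) :
    grid n a ∈ simplex₃ := by
  refine ⟨fun i => by unfold grid; positivity, ?_⟩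
  simp only [grid]
  rw [← Finset.sum_div, ← Nat.cast_sum, ha, div_self (by positivity)]

/-- The vertices of the `n`-fold warped subdivision of the icosahedron. -/
def net (n : ℕ) : Set E3 := {A | ∃ t, IsTri t ∧ ∃ a : Fin 3 → ℕ, ∑ i, a i = n ∧ A = pt t (grid n a)}

theorem net_finite (n : ℕ) : (net n).Finite := by
  refine ((Finset.univ ×ˢ Finset.piAntidiag Finset.univ n).finite_toSet.image
    fun p : (Fin 3 → Fin 12) × (Fin 3 → ℕ) => pt p.1 (grid n p.2)).subset ?_
  rintro _ ⟨t, -, a, ha, rfl⟩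
  exact ⟨(t, a), by simp [ha], rfl⟩

/-- A point of the net in the cone over a face is a grid point of that face. -/
theorem exists_grid_of_mem_cone {n : ℕ} (hn : 0 < n) {B : E3} (hB : B ∈ net n)
    {t : Fin 3 → Fin 12} (ht : IsTri t) {β : Fin 3 → ℝ} (hβ : ∀ i, 0 ≤ β i)
    (hBβ : B = lin t β) : ∃ b : Fin 3 → ℕ, ∑ i, b i = n ∧ B = pt t (grid n b) := by
  obtain ⟨t', ht', b, hb, rfl⟩ := hB
  have hx := grid_mem hn hb
  have hpos := ht'.norm_lin_pos hx
  have h0 : ∀ j, t' j ∉ Set.range t → b j = 0 := by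
    intro j hj
    rw [pt, ← lin_smul] at hBβ
    have := ht.eq_zero_of_lin_eq ht' hβ (fun i => by
      exact mul_nonneg (inv_nonneg.2 hpos.le) (warp_comp_nonneg hx i)) hBβ.symm hj
    rw [Pi.smul_apply, smul_eq_mul, mul_eq_zero] at this
    have h1 := this.resolve_left (inv_pos.2 hpos).ne'
    by_contra hne
    refine (warp_pos (x := grid n b j) ?_ (simplex₃_le_one hx j)).ne' h1
    unfold grid
    have : 0 < b j := Nat.pos_of_ne_zero hne
    positivity
  let c : Fin 12 → ℕ := Function.extend t' b fun _ => 0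
  have hc' : ∀ j, c (t' j) = b j := fun j => ht'.injective.extend_apply b _ j
  have hc0 : ∀ l, l ∉ Set.range t' → c l = 0 := fun l hl =>
    Function.extend_apply' b _ l (by simpa using hl)
  have hc1 : ∀ l, l ∉ Set.range t → c l = 0 := by
    intro l hl
    by_cases h : l ∈ Set.range t'
    · obtain ⟨j, rfl⟩ := h
      rw [hc', h0 j hl]
    · exact hc0 l h
  have hlin : lin t (warp ∘ grid n (c ∘ t)) = lin t' (warp ∘ grid n b) := by
    have e1 : lin t (warp ∘ grid n (c ∘ t)) = ∑ l, warp (c l / n) • ico l :=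
      Fintype.sum_of_injective t ht.injective _ _ (fun l hl => by simp [hc1 l hl, warp_zero])
        fun i => rfl
    have e2 : lin t' (warp ∘ grid n b) = ∑ l, warp (c l / n) • ico l :=
      Fintype.sum_of_injective t' ht'.injective _ _ (fun l hl => by simp [hc0 l hl, warp_zero])
        fun i => by rw [hc']; rfl
    rw [e1, e2]
  refine ⟨c ∘ t, ?_, by rw [pt, pt, hlin]⟩
  rw [← hb, Fintype.sum_of_injective t ht.injective (c ∘ t) c hc1 fun _ => rfl]
  exact (Fintype.sum_of_injective t' ht'.injective b c hc0 fun i => (hc' i).symm).symm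

theorem reflect_add (i i' : Fin 12) (x y : E3) :
    reflect i i' (x + y) = reflect i i' x + reflect i i' y := by
  simp only [reflect, inner_add_left, add_div, add_smul]
  abel

theorem reflect_smul (i i' : Fin 12) (r : ℝ) (x : E3) :
    reflect i i' (r • x) = r • reflect i i' x := by
  simp only [reflect, real_inner_smul_left, smul_sub, smul_smul, mul_div_assoc]

theorem IsOpp.inner_reflect_reflect {i i' : Fin 12} (h : IsOpp i i') (x y : E3) :
    inner ℝ (reflect i i' x) (reflect i i' y) = inner ℝ x y := by
  have h1 := h.norm_reflect (x + y)
  rw [reflect_add] at h1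
  have h2 := norm_add_sq_real x y
  have h3 := norm_add_sq_real (reflect i i' x) (reflect i i' y)
  rw [h.norm_reflect, h.norm_reflect, h1] at h3
  linarith

theorem IsOpp.reflect_mem_net {i i' : Fin 12} (h : IsOpp i i') {n : ℕ} {B : E3}
    (hB : B ∈ net n) : reflect i i' B ∈ net n := by
  obtain ⟨t, ht, b, hb, rfl⟩ := hB
  choose σ hσ using h.exists_reflect_ico
  have hlin : ∀ α, reflect i i' (lin t α) = lin (σ ∘ t) α := by
    intro α
    simp only [lin, Fin.sum_univ_three, reflect_add, reflect_smul, hσ, Function.comp]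
  refine ⟨σ ∘ t, fun a c hac => ?_, b, hb, ?_⟩
  · apply icoDot_eq_of_inner_eq
    simp only [Function.comp]
    rw [← hσ, ← hσ, h.inner_reflect_reflect, inner_ico_of_adj (ht a c hac)]
  · rw [pt, reflect_smul, hlin, ← h.norm_reflect, hlin, pt]

/-- Folding induction: a property of net points that holds in the cone over the face `t` and
is inherited under reflections towards `t` holds on the whole net. -/
theorem net_fold_induction {n : ℕ} {t : Fin 3 → Fin 12} (ht : IsTri t) {P : E3 → Prop}
    (base : ∀ B ∈ net n, ∀ β : Fin 3 → ℝ, (∀ i, 0 ≤ β i) → B = lin t β → P B)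
    (step : ∀ a i', IsOpp (t a) i' → (∀ b, b ≠ a → icoDot (t b) i' = ⟨0, 1⟩) →
      ∀ B ∈ net n, inner ℝ B (ico (t a) - ico i') < 0 → P (reflect (t a) i' B) → P B) :
    ∀ B ∈ net n, P B := by
  by_contra! hbad
  obtain ⟨B, ⟨hB, hPB⟩, hmax⟩ :=
    ((net_finite n).subset (Set.sep_subset _ (fun B => ¬P B))).exists_maximalFor
    (fun B => inner ℝ B (lin t 1)) _ hbad
  obtain ⟨β, rfl⟩ := ht.lin_surjective B
  by_cases hβ : ∀ i, 0 ≤ β i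
  · exact hPB (base _ hB β hβ rfl)
  push Not at hβ
  obtain ⟨a, ha⟩ := hβ
  obtain ⟨i', ho, h⟩ := ht.exists_opp a
  have hφ := goldenRatio_pos
  have hin := ht.inner_lin_sub ho h β
  have hneg : β a * (2 * goldenRatio ^ 2) < 0 := mul_neg_of_neg_of_pos ha (by positivity)
  have hP' : ¬P (reflect (t a) i' (lin t β)) := fun hP =>
    hPB (step a i' ho h _ hB (hin ▸ hneg) hP)
  have h1 := ht.inner_lin_sub ho h 1
  have hgt : inner ℝ (lin t β) (lin t 1) < inner ℝ (reflect (t a) i' (lin t β)) (lin t 1) := by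
    rw [reflect, inner_sub_left, real_inner_smul_left,
      real_inner_comm (lin t 1) (ico (t a) - ico i'), h1, hin,
      Pi.one_apply, mul_div_assoc, div_self (by positivity)]
    linarith
  exact absurd (hmax ⟨ho.reflect_mem_net hB, hP'⟩ hgt.le) (not_le.2 hgt)

def normSq (x : Fin 3 → ℝ) : ℝ := normForm (warp (x 0)) (warp (x 1)) (warp (x 2))

/-- The squared rate of change of the direction of `lin t (warp ∘ x)` along the edge from
`i + 1` to `i`, with slopes measured between `x` and `y`. -/
def edgeForm (x y : Fin 3 → ℝ) (i : Fin 3) : ℝ :=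
  gramForm (warp (x i)) (warp (x (i + 1))) (warp (x (i + 2)))
    (slope₂ (x i) (y i)) (slope₂ (x (i + 1)) (y (i + 1))) / (normSq x * normSq y)

theorem IsTri.norm_lin_warp_sq {t : Fin 3 → Fin 12} (ht : IsTri t) (x : Fin 3 → ℝ) :
    ‖lin t (warp ∘ x)‖ ^ 2 = normSq x := ht.norm_lin_sq _

theorem normSq_pos {x : Fin 3 → ℝ} (hx : x ∈ simplex₃) : 0 < normSq x := by
  obtain ⟨t, ht⟩ := exists_isTri
  rw [← ht.norm_lin_warp_sq]
  exact pow_pos (ht.norm_lin_pos hx) 2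

theorem normSq_rotate (x : Fin 3 → ℝ) (i : Fin 3) :
    normForm (warp (x i)) (warp (x (i + 1))) (warp (x (i + 2))) = normSq x := by
  unfold normSq normForm
  fin_cases i
  · rfl
  · change 2 * (warp (x 1) ^ 2 + warp (x 2) ^ 2 + warp (x 0) ^ 2) +
      _ * (warp (x 1) + warp (x 2) + warp (x 0)) ^ 2 = _
    rw [show warp (x 1) + warp (x 2) + warp (x 0) = warp (x 0) + warp (x 1) + warp (x 2) by ring]
    ring
  · change 2 * (warp (x 2) ^ 2 + warp (x 0) ^ 2 + warp (x 1) ^ 2) +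
      _ * (warp (x 2) + warp (x 0) + warp (x 1)) ^ 2 = _
    rw [show warp (x 2) + warp (x 0) + warp (x 1) = warp (x 0) + warp (x 1) + warp (x 2) by ring]
    ring

/-- The two-sided conformality bound. -/
theorem edgeForm_self_bounds {x : Fin 3 → ℝ} (hx : x ∈ simplex₃) (i : Fin 3) :
    1024 / 845 ≤ edgeForm x x i ∧ edgeForm x x i ≤ (3 - goldenRatio) * (1024 / 845) := by
  have hsum : x i + x (i + 1) + x (i + 2) = 1 := by
    have := hx.2
    rw [Fin.sum_univ_three] at this
    fin_cases i <;> simp <;> linarith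
  have hpos := normSq_pos hx
  have hpos2 : 0 < normSq x * normSq x := mul_pos hpos hpos
  obtain ⟨h1, h2⟩ := forms_nonneg (hx.1 i) (hx.1 (i + 1)) (hx.1 (i + 2))
  rw [hsum] at h1 h2
  have h3 := normSq_rotate x i
  simp only [lowerForm, upperForm, ← slope₂_self] at h1 h2
  simp only [show ∀ x, gHom 1 x = warp x from fun _ => rfl] at h1 h2
  rw [h3] at h1 h2
  unfold edgeForm
  generalize goldenRatio = p at h2 ⊢
  rw [le_div_iff₀ hpos2, div_le_iff₀ hpos2]
  constructor <;> nlinarith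

theorem isCompact_simplex₃ : IsCompact simplex₃ := by
  have h : IsClosed simplex₃ := by
    have : simplex₃ = (⋂ i, {x : Fin 3 → ℝ | 0 ≤ x i}) ∩ {x | ∑ i, x i = 1} := by
      ext x; simp [simplex₃]
    rw [this]
    exact (isClosed_iInter fun i => isClosed_le continuous_const (continuous_apply i)).inter
      (isClosed_eq (by fun_prop) continuous_const)
  refine (isCompact_univ_pi fun _ => isCompact_Icc (a := (0 : ℝ)) (b := 1)).of_isClosed_subset h ?_
  exact fun x hx i _ => ⟨hx.1 i, simplex₃_le_one hx i⟩

theorem continuous_warp : Continuous warp := by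
  unfold warp gHom; fun_prop

theorem continuousOn_edgeForm (i : Fin 3) :
    ContinuousOn (fun p : (Fin 3 → ℝ) × (Fin 3 → ℝ) => edgeForm p.1 p.2 i)
      (simplex₃ ×ˢ simplex₃) := by
  have hw := continuous_warp
  unfold edgeForm
  refine ContinuousOn.div (Continuous.continuousOn ?_) (Continuous.continuousOn ?_) fun p hp => ?_
  · unfold gramForm normForm slope₂
    fun_prop
  · unfold normSq normForm
    fun_prop
  · exact (mul_pos (normSq_pos hp.1) (normSq_pos hp.2)).ne'

theorem exists_edgeForm_near {ε : ℝ} (hε : 0 < ε) : ∃ δ > 0, ∀ x ∈ simplex₃, ∀ y ∈ simplex₃,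
    dist x y < δ → ∀ i, |edgeForm x y i - edgeForm x x i| < ε := by
  have h : ∀ i, ∃ δ > 0, ∀ x ∈ simplex₃, ∀ y ∈ simplex₃,
      dist x y < δ → |edgeForm x y i - edgeForm x x i| < ε := by
    intro i
    have hu := (isCompact_simplex₃.prod isCompact_simplex₃).uniformContinuousOn_of_continuous
      (continuousOn_edgeForm i)
    obtain ⟨δ, hδ, h⟩ := Metric.uniformContinuousOn_iff.1 hu ε hε
    refine ⟨δ, hδ, fun x hx y hy hxy => ?_⟩
    have := h (x, y) ⟨hx, hy⟩ (x, x) ⟨hx, hx⟩ (by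
      rw [Prod.dist_eq, dist_self]; exact max_lt hδ (by rwa [dist_comm]))
    rwa [Real.dist_eq] at this
  choose δ hδ h using h
  refine ⟨Finset.univ.inf' Finset.univ_nonempty δ, by simpa using hδ, fun x hx y hy hxy i => ?_⟩
  exact h i x hx y hy (hxy.trans_le (Finset.inf'_le _ (Finset.mem_univ i)))

/-- The squared sine of the angle between two points over the same face. -/
theorem IsTri.one_sub_inner_sq {t : Fin 3 → Fin 12} (ht : IsTri t) {x y : Fin 3 → ℝ}
    (hx : x ∈ simplex₃) (hy : y ∈ simplex₃) :
    1 - inner ℝ (pt t x) (pt t y) ^ 2 =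
      -((y 0 - x 0) * (y 1 - x 1) * edgeForm x y 0 + (y 1 - x 1) * (y 2 - x 2) * edgeForm x y 1 +
        (y 2 - x 2) * (y 0 - x 0) * edgeForm x y 2) := by
  have h1 := ht.norm_lin_pos hx
  have h2 := ht.norm_lin_pos hy
  have hnx := normSq_pos hx
  have hny := normSq_pos hy
  have hin : inner ℝ (pt t x) (pt t y) ^ 2 =
      inner ℝ (lin t (warp ∘ x)) (lin t (warp ∘ y)) ^ 2 / (normSq x * normSq y) := by
    rw [pt, pt, real_inner_smul_left, real_inner_smul_right, ← ht.norm_lin_warp_sq,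
      ← ht.norm_lin_warp_sq]
    field_simp
  have hs : (y 2 - x 2) = -(y 0 - x 0) - (y 1 - x 1) := by
    have e1 := hx.2
    have e2 := hy.2
    rw [Fin.sum_univ_three] at e1 e2
    linarith
  rw [hin, ht.inner_lin_lin]
  have w : ∀ i, warp (y i) = warp (x i) + (y i - x i) * slope₂ (x i) (y i) := fun i => by
    rw [← warp_sub_warp]; ring
  have e01 : (0 : Fin 3) + 1 = 1 := rfl
  have e02 : (0 : Fin 3) + 2 = 2 := rfl
  have e11 : (1 : Fin 3) + 1 = 2 := rfl
  have e12 : (1 : Fin 3) + 2 = 0 := rfl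
  have e21 : (2 : Fin 3) + 1 = 0 := rfl
  have e22 : (2 : Fin 3) + 2 = 1 := rfl
  simp only [edgeForm, e01, e02, e11, e12, e21, e22]
  have : normSq x * normSq y ≠ 0 := (mul_pos hnx hny).ne'
  suffices h : normSq x * normSq y -
      (2 * ∑ i, (warp ∘ x) i * (warp ∘ y) i +
        goldenRatio * ((∑ i, (warp ∘ x) i) * ∑ i, (warp ∘ y) i)) ^ 2 +
      ((y 0 - x 0) * (y 1 - x 1) * gramForm (warp (x 0)) (warp (x 1)) (warp (x 2))
        (slope₂ (x 0) (y 0)) (slope₂ (x 1) (y 1)) +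
       (y 1 - x 1) * (y 2 - x 2) * gramForm (warp (x 1)) (warp (x 2)) (warp (x 0))
        (slope₂ (x 1) (y 1)) (slope₂ (x 2) (y 2)) +
       (y 2 - x 2) * (y 0 - x 0) * gramForm (warp (x 2)) (warp (x 0)) (warp (x 1))
        (slope₂ (x 2) (y 2)) (slope₂ (x 0) (y 0))) = 0 by
    revert h
    generalize (2 * ∑ i, (warp ∘ x) i * (warp ∘ y) i +
      goldenRatio * ((∑ i, (warp ∘ x) i) * ∑ i, (warp ∘ y) i)) = b
    intro h
    rw [one_sub_div this, div_eq_iff this, neg_mul]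
    simp only [mul_div_assoc', ← add_div]
    rw [div_mul_cancel₀ _ this]
    linarith
  simp only [Fin.sum_univ_three, Function.comp, normSq, w, hs]
  generalize warp (x 0) = w0
  generalize warp (x 1) = w1
  generalize warp (x 2) = w2
  generalize slope₂ (x 0) (y 0) = q0
  generalize slope₂ (x 1) (y 1) = q1
  generalize slope₂ (x 2) (y 2) = q2
  generalize y 0 - x 0 = v0
  generalize y 1 - x 1 = v1
  unfold gramForm normForm
  generalize goldenRatio = p
  ring

theorem IsTri.inner_pt_nonneg {t : Fin 3 → Fin 12} (ht : IsTri t) {x y : Fin 3 → ℝ}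
    (hx : x ∈ simplex₃) (hy : y ∈ simplex₃) : 0 ≤ inner ℝ (pt t x) (pt t y) := by
  have hφ := goldenRatio_pos
  have h1 := warp_comp_nonneg hx
  have h2 := warp_comp_nonneg hy
  rw [pt, pt, real_inner_smul_left, real_inner_smul_right, ht.inner_lin_lin]
  have s1 : 0 ≤ ∑ i, (warp ∘ x) i := Finset.sum_nonneg fun i _ => h1 i
  have s2 : 0 ≤ ∑ i, (warp ∘ y) i := Finset.sum_nonneg fun i _ => h2 i
  have s3 : 0 ≤ ∑ i, (warp ∘ x) i * (warp ∘ y) i :=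
    Finset.sum_nonneg fun i _ => mul_nonneg (h1 i) (h2 i)
  positivity

/-- Comparison of chord and sine over a common face. -/
theorem IsTri.dist_pt_sq_bounds {t : Fin 3 → Fin 12} (ht : IsTri t) {x y : Fin 3 → ℝ}
    (hx : x ∈ simplex₃) (hy : y ∈ simplex₃) :
    1 - inner ℝ (pt t x) (pt t y) ^ 2 ≤ dist (pt t x) (pt t y) ^ 2 ∧
    dist (pt t x) (pt t y) ^ 2 ≤ (1 - inner ℝ (pt t x) (pt t y) ^ 2) +
      (1 - inner ℝ (pt t x) (pt t y) ^ 2) ^ 2 := by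
  have h1 := real_inner_le_norm (pt t x) (pt t y)
  rw [ht.norm_pt hx, ht.norm_pt hy, one_mul] at h1
  have h0 := ht.inner_pt_nonneg hx hy
  rw [dist_sq_eq_of_norm_eq_one (ht.norm_pt hx) (ht.norm_pt hy)]
  generalize inner ℝ (pt t x) (pt t y) = c at *
  constructor
  · nlinarith [sq_nonneg (1 - c)]
  · have : 0 ≤ c * (1 - c) ^ 2 * (2 + c) := by
      have := sq_nonneg (1 - c)
      positivity
    nlinarith

theorem IsTri.pt_injOn {t : Fin 3 → Fin 12} (ht : IsTri t) : Set.InjOn (pt t) simplex₃ := by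
  have key : ∀ x ∈ simplex₃, ∀ y ∈ simplex₃, pt t x = pt t y →
      ‖lin t (warp ∘ x)‖⁻¹ ≤ ‖lin t (warp ∘ y)‖⁻¹ → x = y := by
    intro x hx y hy h hle
    rw [pt, pt, ← lin_smul, ← lin_smul] at h
    have h1 := ht.lin_injective h
    have hpos := inv_pos.2 (ht.norm_lin_pos hx)
    have hge : ∀ i, y i ≤ x i := by
      intro i
      have e : ‖lin t (warp ∘ x)‖⁻¹ * warp (x i) = ‖lin t (warp ∘ y)‖⁻¹ * warp (y i) :=
        congrFun h1 i
      refine (warp_strictMonoOn.le_iff_le ⟨hy.1 i, simplex₃_le_one hy i⟩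
        ⟨hx.1 i, simplex₃_le_one hx i⟩).1 ?_
      have := mul_le_mul_of_nonneg_right hle (warp_comp_nonneg hy i)
      rw [Function.comp, ← e] at this
      exact le_of_mul_le_mul_left this hpos
    have hs : ∑ i, y i = ∑ i, x i := by rw [hx.2, hy.2]
    rw [Finset.sum_eq_sum_iff_of_le fun i _ => hge i] at hs
    funext i
    exact (hs i (Finset.mem_univ i)).symm
  intro x hx y hy h
  rcases le_total ‖lin t (warp ∘ x)‖⁻¹ ‖lin t (warp ∘ y)‖⁻¹ with hle | hle
  · exact key x hx y hy h hle
  · exact (key y hy x hx h.symm hle).symm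

theorem IsTri.continuousOn_pt {t : Fin 3 → Fin 12} (ht : IsTri t) :
    ContinuousOn (pt t) simplex₃ := by
  have hw := continuous_warp
  have hl : Continuous fun x => lin t (warp ∘ x) := by
    unfold lin
    simp only [Function.comp]
    fun_prop
  unfold pt
  exact (hl.norm.continuousOn.inv₀ fun x hx => (ht.norm_lin_pos hx).ne').smul hl.continuousOn

theorem IsTri.exists_le_dist_pt {t : Fin 3 → Fin 12} (ht : IsTri t) {δ : ℝ} (hδ : 0 < δ) :
    ∃ η > 0, ∀ x ∈ simplex₃, ∀ y ∈ simplex₃, δ ≤ dist x y → η ≤ dist (pt t x) (pt t y) := by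
  have hK : IsCompact ((simplex₃ ×ˢ simplex₃) ∩ {p | δ ≤ dist p.1 p.2}) :=
    (isCompact_simplex₃.prod isCompact_simplex₃).inter_right
      (isClosed_le continuous_const (by fun_prop))
  have hc : ContinuousOn (fun p : (Fin 3 → ℝ) × (Fin 3 → ℝ) => dist (pt t p.1) (pt t p.2))
      ((simplex₃ ×ˢ simplex₃) ∩ {p | δ ≤ dist p.1 p.2}) :=
    continuous_dist.comp_continuousOn
      ((ht.continuousOn_pt.comp continuousOn_fst fun p hp => hp.1.1).prodMk
        (ht.continuousOn_pt.comp continuousOn_snd fun p hp => hp.1.2))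
  obtain ⟨η, hη, h⟩ := hK.exists_forall_le' hc (a := 0) (by
    rintro ⟨x, y⟩ ⟨⟨hx, hy⟩, hxy⟩
    refine dist_pos.2 fun h => ?_
    have hd : δ ≤ dist x y := hxy
    rw [show x = y from ht.pt_injOn hx hy h, dist_self] at hd
    linarith)
  exact ⟨η, hη, fun x hx y hy hxy => h (x, y) ⟨⟨hx, hy⟩, hxy⟩⟩

theorem form_bounds_of_mul_nonneg {ε W A B C : ℝ} (h0 : 0 < ε) (hε : ε ≤ 1 / 20) (hW : 0 < W)
    (hA : (1 - ε) * W ≤ A ∧ A ≤ (3 - goldenRatio + ε) * W)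
    (hB : (1 - ε) * W ≤ B ∧ B ≤ (3 - goldenRatio + ε) * W)
    (hC : C ≤ (3 - goldenRatio + ε) * W)
    {p q : ℤ} (hpq : 0 ≤ p * q) (hne : p ≠ 0 ∨ q ≠ 0) :
    (1 - ε) * W ≤ p ^ 2 * A + q ^ 2 * B + p * q * (A + B - C) ∧
    (p ^ 2 * A + q ^ 2 * B + p * q * (A + B - C) ≤ (3 - goldenRatio + ε) * W ∨
      2 * W ≤ p ^ 2 * A + q ^ 2 * B + p * q * (A + B - C)) := by
  obtain ⟨hφ, -⟩ := goldenRatio_near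
  have hεW : ε * W ≤ 1 / 20 * W := mul_le_mul_of_nonneg_right hε hW.le
  have single : ∀ {A : ℝ} {p : ℤ}, ((1 - ε) * W ≤ A ∧ A ≤ (3 - goldenRatio + ε) * W) → p ≠ 0 →
      (1 - ε) * W ≤ p ^ 2 * A ∧ (p ^ 2 * A ≤ (3 - goldenRatio + ε) * W ∨ 2 * W ≤ p ^ 2 * A) := by
    intro A p hA hp
    by_cases h1 : |p| = 1
    · have : (p : ℝ) ^ 2 = 1 := by
        rw [← sq_abs]; exact_mod_cast by rw [h1]; rfl
      rw [this, one_mul]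
      exact ⟨hA.1, .inl hA.2⟩
    · have h2 : 2 ≤ |p| := by
        have := abs_pos.2 hp
        omega
      have h4 : (4 : ℝ) ≤ p ^ 2 := by
        rw [← sq_abs]
        have : (2 : ℝ) ≤ |(p : ℝ)| := by exact_mod_cast h2
        nlinarith
      have : 4 * ((1 - ε) * W) ≤ p ^ 2 * A :=
        mul_le_mul h4 hA.1 (by nlinarith) (by positivity)
      constructor
      · nlinarith
      · right; nlinarith
  rcases hpq.eq_or_lt with h | h
  · rw [show (p : ℝ) * q = 0 by exact_mod_cast h.symm, zero_mul, add_zero]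
    rcases mul_eq_zero.1 h.symm with rfl | rfl
    · simpa using single hB (by simpa using hne)
    · simpa using single hA (by simpa using hne)
  · have hp : p ≠ 0 := by rintro rfl; simp at h
    have hq : q ≠ 0 := by rintro rfl; simp at h
    have e1 : (1 : ℝ) ≤ p ^ 2 := by
      exact_mod_cast Order.one_le_iff_pos.2 (by positivity : 0 < p ^ 2)
    have e2 : (1 : ℝ) ≤ q ^ 2 := by
      exact_mod_cast Order.one_le_iff_pos.2 (by positivity : 0 < q ^ 2)
    have e3 : (1 : ℝ) ≤ p * q := by exact_mod_cast h
    have hd : 0 ≤ (1 - ε) * W := by nlinarith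
    have f1 : 1 * ((1 - ε) * W) ≤ p ^ 2 * A := mul_le_mul e1 hA.1 hd (by positivity)
    have f2 : 1 * ((1 - ε) * W) ≤ q ^ 2 * B := mul_le_mul e2 hB.1 hd (by positivity)
    have hφW : 1.618 * W ≤ goldenRatio * W := mul_le_mul_of_nonneg_right hφ.le hW.le
    have f4 : 0.46 * W ≤ A + B - C := by
      generalize goldenRatio = r at *
      linarith [hA.1, hB.1, hC]
    have f3 : 1 * (0.46 * W) ≤ p * q * (A + B - C) := mul_le_mul e3 f4 (by positivity) (by linarith)
    constructor
    · linarith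
    · right; linarith

theorem form_bounds {ε W : ℝ} (h0 : 0 < ε) (hε : ε ≤ 1 / 20) (hW : 0 < W) {m : Fin 3 → ℝ}
    (hm : ∀ i, (1 - ε) * W ≤ m i ∧ m i ≤ (3 - goldenRatio + ε) * W)
    {z : Fin 3 → ℤ} (hz : ∑ i, z i = 0) (hne : z ≠ 0) {X : ℝ}
    (hX : X = -(z 0 * z 1 * m 0 + z 1 * z 2 * m 1 + z 2 * z 0 * m 2)) :
    (1 - ε) * W ≤ X ∧ (X ≤ (3 - goldenRatio + ε) * W ∨ 2 * W ≤ X) := by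
  rw [Fin.sum_univ_three] at hz
  have hne' : ∃ i, z i ≠ 0 := Function.ne_iff.1 hne
  have hzr : (z 0 : ℝ) + z 1 + z 2 = 0 := by exact_mod_cast hz
  have : z 0 ≠ 0 ∨ z 1 ≠ 0 ∨ z 2 ≠ 0 := by
    by_contra! h
    exact hne (by funext i; fin_cases i <;> simp [h])
  have hcases : 0 ≤ z 0 * z 1 ∨ 0 ≤ z 1 * z 2 ∨ 0 ≤ z 2 * z 0 := by
    by_contra! h
    have := mul_pos_of_neg_of_neg h.1 h.2.1
    nlinarith [sq_nonneg (z 1)]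
  rcases hcases with h | h | h
  · have := form_bounds_of_mul_nonneg h0 hε hW (hm 2) (hm 1) (hm 0).2 h (by omega)
    convert this using 2 <;> rw [hX, show (z 2 : ℝ) = -z 0 - z 1 by linarith] <;> ring_nf
  · have := form_bounds_of_mul_nonneg h0 hε hW (hm 0) (hm 2) (hm 1).2 h (by omega)
    convert this using 2 <;> rw [hX, show (z 0 : ℝ) = -z 1 - z 2 by linarith] <;> ring_nf
  · have := form_bounds_of_mul_nonneg h0 hε hW (hm 1) (hm 0) (hm 2).2 h (by omega)
    convert this using 2 <;> rw [hX, show (z 1 : ℝ) = -z 2 - z 0 by linarith] <;> ring_nf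

/-- Distances between grid points of a common face, in units of `1 / n`. -/
theorem IsTri.eventually_separated {t : Fin 3 → Fin 12} (ht : IsTri t) {ε : ℝ} (h0 : 0 < ε)
    (hε : ε ≤ 1 / 20) : ∀ᶠ n : ℕ in atTop, ∀ a b : Fin 3 → ℕ, ∑ i, a i = n → ∑ i, b i = n →
      a ≠ b → (1 - ε) * (1024 / 845) ≤ n ^ 2 * dist (pt t (grid n a)) (pt t (grid n b)) ^ 2 ∧
        (n ^ 2 * dist (pt t (grid n a)) (pt t (grid n b)) ^ 2 ≤
            (3 - goldenRatio + 2 * ε) * (1024 / 845) ∨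
          1.99 * (1024 / 845) ≤ n ^ 2 * dist (pt t (grid n a)) (pt t (grid n b)) ^ 2) := by
  obtain ⟨hφ, hφ'⟩ := goldenRatio_near
  obtain ⟨δ, hδ, hnear⟩ := exists_edgeForm_near h0
  obtain ⟨η, hη, hfar⟩ := ht.exists_le_dist_pt hδ
  have l1 : ∀ᶠ n : ℕ in atTop, 2 / η ≤ (n : ℝ) := tendsto_natCast_atTop_atTop.eventually_ge_atTop _
  have l2 : ∀ᶠ n : ℕ in atTop, 10 / ε ≤ (n : ℝ) := tendsto_natCast_atTop_atTop.eventually_ge_atTop _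
  filter_upwards [l1, l2, eventually_gt_atTop 0] with n hn1 hn2 hn a b ha hb hab
  have hn' : (0 : ℝ) < n := by exact_mod_cast hn
  have hx := grid_mem hn ha
  have hy := grid_mem hn hb
  rcases le_or_gt δ (dist (grid n a) (grid n b)) with hd | hd
  · have h1 := hfar _ hx _ hy hd
    rw [div_le_iff₀ hη] at hn1
    have h2 : 2 ≤ n * dist (pt t (grid n a)) (pt t (grid n b)) :=
      hn1.trans (mul_le_mul_of_nonneg_left h1 hn'.le)
    have h3 : 4 ≤ (n : ℝ) ^ 2 * dist (pt t (grid n a)) (pt t (grid n b)) ^ 2 := by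
      rw [← mul_pow]; nlinarith
    constructor
    · nlinarith
    · right; norm_num at h3 ⊢; linarith
  · have hm : ∀ i, (1 - ε) * (1024 / 845) ≤ edgeForm (grid n a) (grid n b) i ∧
        edgeForm (grid n a) (grid n b) i ≤ (3 - goldenRatio + ε) * (1024 / 845) := by
      intro i
      have h1 := abs_lt.1 (hnear _ hx _ hy hd i)
      have h2 := edgeForm_self_bounds hx i
      generalize goldenRatio = r at *
      constructor <;> linarith
    let z : Fin 3 → ℤ := fun i => b i - a i
    have hz : ∑ i, z i = 0 := by
      simp only [z, Finset.sum_sub_distrib]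
      rw [← Nat.cast_sum, ← Nat.cast_sum, ha, hb, sub_self]
    have hzne : z ≠ 0 := by
      intro h
      apply hab
      funext i
      have := congrFun h i
      simp only [z, Pi.zero_apply] at this
      omega
    obtain ⟨d1, d2⟩ := ht.dist_pt_sq_bounds hx hy
    rw [ht.one_sub_inner_sq hx hy] at d1 d2
    have hdiff : ∀ i, grid n b i - grid n a i = z i / n := fun i => by
      simp only [grid, z]; push_cast; ring
    simp only [hdiff] at d1 d2
    have hX := form_bounds h0 hε (by norm_num : (0:ℝ) < 1024 / 845) hm hz hzne rfl
    set X := -((z 0 : ℝ) * z 1 * edgeForm (grid n a) (grid n b) 0 +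
      z 1 * z 2 * edgeForm (grid n a) (grid n b) 1 +
      z 2 * z 0 * edgeForm (grid n a) (grid n b) 2) with hXdef
    have hS : -((z 0 : ℝ) / n * (z 1 / n) * edgeForm (grid n a) (grid n b) 0 +
      z 1 / n * (z 2 / n) * edgeForm (grid n a) (grid n b) 1 +
      z 2 / n * (z 0 / n) * edgeForm (grid n a) (grid n b) 2) = X / n ^ 2 := by
      rw [hXdef]; ring
    rw [hS] at d1 d2
    have hn2' : (0 : ℝ) < n ^ 2 := by positivity
    rw [div_le_iff₀' hn2'] at d1
    have d3 : (n : ℝ) ^ 2 * dist (pt t (grid n a)) (pt t (grid n b)) ^ 2 ≤ X + X ^ 2 / n ^ 2 := by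
      refine (mul_le_mul_of_nonneg_left d2 hn2'.le).trans_eq ?_
      field_simp
    refine ⟨hX.1.trans d1, ?_⟩
    rcases hX.2 with h | h
    · left
      have hX0 : 0 ≤ X := le_trans (by nlinarith) hX.1
      have hX2 : X ≤ 2 := by
        refine h.trans ?_
        generalize goldenRatio = r at *
        linarith
      rw [div_le_iff₀ h0] at hn2
      have hn1' : (1 : ℝ) ≤ n := by exact_mod_cast hn
      have : X ^ 2 / n ^ 2 ≤ ε := by
        rw [div_le_iff₀ hn2']
        nlinarith
      generalize goldenRatio = r at *
      linarith
    · right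
      refine le_trans ?_ d1
      norm_num at h ⊢
      linarith

/-- Every point of the simplex is a convex combination of grid points of one small triangle. -/
theorem exists_grid_triangle {n : ℕ} (hn : 0 < n) {x : Fin 3 → ℝ} (hx : x ∈ simplex₃) :
    ∃ (a : Fin 3 → Fin 3 → ℕ) (w : Fin 3 → ℝ) (σ : ℝ), (∀ j, ∑ i, a j i = n) ∧
      (∀ j, 0 ≤ w j) ∧ ∑ j, w j = 1 ∧ |σ| ≤ 1 ∧
      ∀ j i, n * (grid n (a j) i - x i) = σ * ((if i = j then 1 else 0) - w i) := by
  have hn' : (0 : ℝ) < n := by exact_mod_cast hn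
  let k : Fin 3 → ℕ := fun i => ⌊n * x i⌋₊
  let r : Fin 3 → ℝ := fun i => n * x i - k i
  have hr0 : ∀ i, 0 ≤ r i := fun i =>
    sub_nonneg.2 (Nat.floor_le (mul_nonneg hn'.le (hx.1 i)))
  have hr1 : ∀ i, r i < 1 := fun i => by
    have := Nat.lt_floor_add_one ((n : ℝ) * x i)
    simp only [r, k]; linarith
  have hsum : ∑ i, r i + ((∑ i, k i : ℕ) : ℝ) = n := by
    push_cast
    rw [← Finset.sum_add_distrib]
    simp only [r, sub_add_cancel]
    rw [← Finset.mul_sum, hx.2, mul_one]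
  have hgrid : ∀ (b : Fin 3 → ℕ) i, n * (grid n b i - x i) = b i - k i - r i := fun b i => by
    simp only [grid, r]; field_simp; ring
  have hlt : ∑ i, r i < 3 := by
    rw [Fin.sum_univ_three]; linarith [hr1 0, hr1 1, hr1 2]
  have hge : 0 ≤ ∑ i, r i := Finset.sum_nonneg fun i _ => hr0 i
  have c1 : ∑ i, k i ≤ n := by
    have : ((∑ i, k i : ℕ) : ℝ) ≤ n := by linarith
    exact_mod_cast this
  have c2 : n < ∑ i, k i + 3 := by
    have : (n : ℝ) < ((∑ i, k i : ℕ) : ℝ) + 3 := by linarith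
    exact_mod_cast this
  have hδ : ∀ j : Fin 3, ∑ i, (if i = j then 1 else 0 : ℕ) = 1 := fun j => by simp
  obtain h | h | h : n = ∑ i, k i ∨ n = ∑ i, k i + 1 ∨ n = ∑ i, k i + 2 := by omega
  · have hr : ∀ i, r i = 0 := by
      have : ∑ i, r i = 0 := by rw [← h] at hsum; linarith
      rw [Finset.sum_eq_zero_iff_of_nonneg fun i _ => hr0 i] at this
      exact fun i => this i (Finset.mem_univ i)
    refine ⟨fun _ => k, fun _ => 1 / 3, 0, fun _ => h.symm, fun _ => by norm_num, by simp,
      by simp, fun j i => ?_⟩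
    rw [hgrid, hr]; ring
  · refine ⟨fun j i => k i + if i = j then 1 else 0, r, 1, fun j => ?_, hr0, ?_, by simp,
      fun j i => ?_⟩
    · rw [Finset.sum_add_distrib, hδ, h]
    · have : (n : ℝ) = ((∑ i, k i : ℕ) : ℝ) + 1 := by exact_mod_cast h
      linarith
    · rw [hgrid]; push_cast; ring
  · refine ⟨fun j i => k i + if i = j then 0 else 1, fun i => 1 - r i, -1, fun j => ?_,
      fun i => sub_nonneg.2 (hr1 i).le, ?_, by simp, fun j i => ?_⟩
    · have : ∀ j : Fin 3, ∑ i, (if i = j then 0 else 1 : ℕ) = 2 := by decide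
      rw [Finset.sum_add_distrib, this, h]
    · have : (n : ℝ) = ((∑ i, k i : ℕ) : ℝ) + 2 := by exact_mod_cast h
      rw [Finset.sum_sub_distrib]
      simp only [Finset.sum_const, Finset.card_univ, Fintype.card_fin, nsmul_eq_mul]
      push_cast
      linarith
    · rw [hgrid]; push_cast; split_ifs <;> ring

/-- Some vertex of a triangle is close to a given interior point for a quadratic form. -/
theorem exists_form_le {w m : Fin 3 → ℝ} (hw : ∀ j, 0 ≤ w j) (hw1 : ∑ j, w j = 1) {M : ℝ}
    (hM0 : 0 ≤ M) (hM : ∀ i, m i ≤ M) : ∃ j : Fin 3, ∀ u : Fin 3 → ℝ,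
      (∀ i, u i = (if i = j then 1 else 0) - w i) →
      -(u 0 * u 1 * m 0 + u 1 * u 2 * m 1 + u 2 * u 0 * m 2) ≤ M / 3 := by
  by_contra! h
  choose u hu hlt using h
  have hsum : ∑ j, w j * -(u j 0 * u j 1 * m 0 + u j 1 * u j 2 * m 1 + u j 2 * u j 0 * m 2) =
      w 0 * w 1 * m 0 + w 1 * w 2 * m 1 + w 2 * w 0 * m 2 := by
    have : w 2 = 1 - w 0 - w 1 := by rw [Fin.sum_univ_three] at hw1; linarith
    simp only [hu, Fin.sum_univ_three]
    simp [this]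
    ring
  have hle : w 0 * w 1 * m 0 + w 1 * w 2 * m 1 + w 2 * w 0 * m 2 ≤ M / 3 := by
    have a0 := mul_le_mul_of_nonneg_left (hM 0) (mul_nonneg (hw 0) (hw 1))
    have a1 := mul_le_mul_of_nonneg_left (hM 1) (mul_nonneg (hw 1) (hw 2))
    have a2 := mul_le_mul_of_nonneg_left (hM 2) (mul_nonneg (hw 2) (hw 0))
    have a3 : w 0 * w 1 + w 1 * w 2 + w 2 * w 0 ≤ 1 / 3 := by
      rw [Fin.sum_univ_three] at hw1
      have : (w 0 + w 1 + w 2) ^ 2 = 1 := by rw [hw1, one_pow]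
      nlinarith [sq_nonneg (w 0 - w 1), sq_nonneg (w 0 - w 2), sq_nonneg (w 1 - w 2)]
    have a4 := mul_le_mul_of_nonneg_right a3 hM0
    linarith
  have hgt : ∑ j, w j * (M / 3) <
      ∑ j, w j * -(u j 0 * u j 1 * m 0 + u j 1 * u j 2 * m 1 + u j 2 * u j 0 * m 2) := by
    apply Finset.sum_lt_sum (fun j _ => mul_le_mul_of_nonneg_left (hlt j).le (hw j))
    obtain ⟨j, hj⟩ : ∃ j, 0 < w j := by
      by_contra! h0
      have := Finset.sum_nonpos fun j (_ : j ∈ Finset.univ) => h0 j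
      linarith
    exact ⟨j, Finset.mem_univ j, mul_lt_mul_of_pos_left (hlt j) hj⟩
  rw [← Finset.sum_mul, hw1, one_mul, hsum] at hgt
  linarith

/-- The grid points of a face form a net of radius `0.7` in units of `√(1024 / 845) / n`. -/
theorem IsTri.eventually_covering {t : Fin 3 → Fin 12} (ht : IsTri t) :
    ∀ᶠ n : ℕ in atTop, ∀ x ∈ simplex₃, ∃ a : Fin 3 → ℕ, ∑ i, a i = n ∧
      n ^ 2 * dist (pt t x) (pt t (grid n a)) ^ 2 ≤ 0.49 * (1024 / 845) := by
  obtain ⟨hφ, hφ'⟩ := goldenRatio_near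
  obtain ⟨δ, hδ, hnear⟩ := exists_edgeForm_near (by norm_num : (0 : ℝ) < 0.004)
  have l1 : ∀ᶠ n : ℕ in atTop, 2 / δ ≤ (n : ℝ) := tendsto_natCast_atTop_atTop.eventually_ge_atTop _
  filter_upwards [l1, eventually_ge_atTop 20] with n hn1 hn x hx
  have hn20 : (20 : ℝ) ≤ n := by exact_mod_cast hn
  have hn' : (0 : ℝ) < n := by linarith
  have hn2' : (0 : ℝ) < n ^ 2 := by positivity
  obtain ⟨a, w, σ, ha, hw, hw1, hσ, hgrid⟩ := exists_grid_triangle (by omega : 0 < n) hx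
  have hM := fun i => (edgeForm_self_bounds hx i).2
  have hM0 : 0 ≤ (3 - goldenRatio) * (1024 / 845) := by
    generalize goldenRatio = r at *
    linarith
  obtain ⟨j, hj⟩ := exists_form_le hw hw1 hM0 hM
  refine ⟨a j, ha j, ?_⟩
  have hy := grid_mem (by omega : 0 < n) (ha j)
  let u : Fin 3 → ℝ := fun i => (if i = j then 1 else 0) - w i
  have hwle : ∀ i, w i ≤ 1 := fun i =>
    hw1 ▸ Finset.single_le_sum (fun j _ => hw j) (Finset.mem_univ i)
  have hu1 : ∀ i, |u i| ≤ 1 := fun i => by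
    simp only [u]
    have := hw i
    have := hwle i
    rw [abs_le]
    split_ifs <;> constructor <;> linarith
  have hσ2 : σ ^ 2 ≤ 1 := by rw [← sq_abs]; exact pow_le_one₀ (abs_nonneg σ) hσ
  have hdiff : ∀ i, grid n (a j) i - x i = σ * u i / n := fun i => by
    rw [eq_div_iff hn'.ne', mul_comm]; exact hgrid j i
  have hd : dist x (grid n (a j)) < δ := by
    rw [dist_comm]
    refine lt_of_le_of_lt ((dist_pi_le_iff (by positivity : 0 ≤ 1 / (n : ℝ))).2 fun i => ?_) ?_
    · rw [Real.dist_eq, hdiff, abs_div, abs_mul, abs_of_pos hn']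
      have := mul_le_one₀ hσ (abs_nonneg _) (hu1 i)
      gcongr
    · rw [div_le_iff₀ hδ] at hn1
      rw [div_lt_iff₀ hn']
      linarith
  have hm := hnear x hx _ hy hd
  obtain ⟨-, d2⟩ := ht.dist_pt_sq_bounds hx hy
  have hS0 : 0 ≤ 1 - inner ℝ (pt t x) (pt t (grid n (a j))) ^ 2 := by
    have h1 := real_inner_le_norm (pt t x) (pt t (grid n (a j)))
    rw [ht.norm_pt hx, ht.norm_pt hy, one_mul] at h1
    exact sub_nonneg.2 (pow_le_one₀ (ht.inner_pt_nonneg hx hy) h1)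
  rw [ht.one_sub_inner_sq hx hy] at d2 hS0
  simp only [hdiff] at d2 hS0
  set X := -(u 0 * u 1 * edgeForm x (grid n (a j)) 0 + u 1 * u 2 * edgeForm x (grid n (a j)) 1 +
    u 2 * u 0 * edgeForm x (grid n (a j)) 2) with hXdef
  have hS : -(σ * u 0 / n * (σ * u 1 / n) * edgeForm x (grid n (a j)) 0 +
      σ * u 1 / n * (σ * u 2 / n) * edgeForm x (grid n (a j)) 1 +
      σ * u 2 / n * (σ * u 0 / n) * edgeForm x (grid n (a j)) 2) = σ ^ 2 * X / n ^ 2 := by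
    rw [hXdef]; ring
  rw [hS] at d2 hS0
  have hXle : X ≤ (3 - goldenRatio) * (1024 / 845) / 3 + 3 * 0.004 := by
    have e0 := hj u fun i => rfl
    have e : ∀ i i' k, -(u i * u i' * edgeForm x (grid n (a j)) k) ≤
        -(u i * u i' * edgeForm x x k) + 0.004 := by
      intro i i' k
      have h1 : |u i * u i' * (edgeForm x (grid n (a j)) k - edgeForm x x k)| ≤ 1 * 0.004 := by
        rw [abs_mul, abs_mul]
        exact mul_le_mul (mul_le_one₀ (hu1 i) (abs_nonneg _) (hu1 i')) (hm k).le
          (abs_nonneg _) zero_le_one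
      have := neg_le_of_abs_le h1
      linarith
    have := e 0 1 0
    have := e 1 2 1
    have := e 2 0 2
    generalize goldenRatio = r at *
    linarith
  have hX57 : X ≤ 0.574 := by
    refine hXle.trans ?_
    generalize goldenRatio = r at *
    norm_num
    linarith
  have hσX : σ ^ 2 * X ≤ 0.574 := by
    rcases le_total X 0 with h | h
    · exact (mul_nonpos_of_nonneg_of_nonpos (sq_nonneg σ) h).trans (by norm_num)
    · exact (mul_le_of_le_one_left h hσ2).trans hX57
  have hσX0 : 0 ≤ σ ^ 2 * X := by
    rw [le_div_iff₀ hn2', zero_mul] at hS0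
    exact hS0
  have d3 : (n : ℝ) ^ 2 * dist (pt t x) (pt t (grid n (a j))) ^ 2 ≤
      σ ^ 2 * X + (σ ^ 2 * X) ^ 2 / n ^ 2 := by
    refine (mul_le_mul_of_nonneg_left d2 hn2'.le).trans_eq ?_
    field_simp
  have d4 : (σ ^ 2 * X) ^ 2 / n ^ 2 ≤ 0.01 := by
    rw [div_le_iff₀ hn2']
    nlinarith
  norm_num at *
  linarith

/-- The warped faces cover the sphere. -/
theorem exists_pt_eq {c : E3} (hc : ‖c‖ = 1) : ∃ t, IsTri t ∧ ∃ x ∈ simplex₃, c = pt t x := by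
  obtain ⟨t, ht, α, hα, rfl⟩ := exists_lin_nonneg c
  refine ⟨t, ht, ?_⟩
  let cl : ℝ → ℝ := fun x => max 0 (min 1 x)
  let G : ℝ → ℝ := fun x => warp (cl x) + (x - cl x)
  have hcl : ∀ x, cl x ∈ Set.Icc (0 : ℝ) 1 := fun x =>
    ⟨le_max_left _ _, max_le zero_le_one (min_le_left _ _)⟩
  have hclid : ∀ x ∈ Set.Icc (0 : ℝ) 1, cl x = x := fun x hx => by
    simp only [cl]; rw [min_eq_right hx.2, max_eq_right hx.1]
  have hGeq : ∀ x ∈ Set.Icc (0 : ℝ) 1, G x = warp x := fun x hx => by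
    simp only [G]; rw [hclid x hx]; ring
  have hGc : Continuous G := by
    have := continuous_warp
    simp only [G, cl]; fun_prop
  have hGm : StrictMono G := by
    intro x y hxy
    have h1 : cl x ≤ cl y := max_le_max le_rfl (min_le_min le_rfl hxy.le)
    have h2 : cl y - cl x ≤ y - x := by
      simp only [cl]
      rcases max_cases 0 (min 1 y) with h | h <;> rcases min_cases 1 y with h' | h' <;>
        rcases max_cases 0 (min 1 x) with h'' | h'' <;> rcases min_cases 1 x with h''' | h''' <;>
        linarith
    simp only [G]
    rcases h1.eq_or_lt with h | h
    · rw [h]; linarith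
    · have := warp_strictMonoOn (hcl x) (hcl y) h
      linarith
  have hGs : Function.Surjective G := by
    apply hGc.surjective
    · refine tendsto_atTop_mono (f := fun x => x + -1) (fun x => ?_)
        (tendsto_atTop_add_const_right _ _ tendsto_id)
      have := warp_nonneg (hcl x).1 (hcl x).2
      have := (hcl x).2
      simp only [G]; linarith
    · refine tendsto_atBot_mono (show ∀ x, G x ≤ x + warp 1 from fun x => ?_)
        (tendsto_atBot_add_const_right _ _ tendsto_id)
      have := warp_strictMonoOn.monotoneOn (hcl x) (⟨zero_le_one, le_rfl⟩ : (1 : ℝ) ∈ Set.Icc 0 1)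
        (hcl x).2
      have := (hcl x).1
      simp only [G]; linarith
  let I := hGm.orderIsoOfSurjective G hGs
  have hGI : ∀ y, G (I.symm y) = y := fun y => I.apply_symm_apply y
  have hI0 : I.symm 0 = 0 := by
    rw [OrderIso.symm_apply_eq]
    exact (((hGeq 0 ⟨le_rfl, zero_le_one⟩).trans warp_zero)).symm
  have hInn : ∀ y, 0 ≤ y → 0 ≤ I.symm y := fun y hy => hI0 ▸ I.symm.monotone hy
  have hI1 : I.symm (warp 1) = 1 := by
    rw [OrderIso.symm_apply_eq]
    exact (hGeq 1 ⟨zero_le_one, le_rfl⟩).symm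
  obtain ⟨j, hj⟩ : ∃ j, 0 < α j := by
    by_contra! h
    have : α = 0 := funext fun i => le_antisymm (h i) (hα i)
    rw [this] at hc
    simp [lin] at hc
  have hw1 : 0 < warp 1 := warp_pos one_pos le_rfl
  let F : ℝ → ℝ := fun r => ∑ i, I.symm (r * α i)
  have hF : Continuous F := by
    have := I.symm.continuous
    simp only [F]; fun_prop
  have hF0 : F 0 = 0 := by simp [F, hI0]
  have hF1 : 1 ≤ F (warp 1 / α j) := by
    have := Finset.single_le_sum (f := fun i => I.symm (warp 1 / α j * α i))
      (fun i _ => hInn _ (mul_nonneg (div_pos hw1 hj).le (hα i))) (Finset.mem_univ j)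
    simp only [div_mul_cancel₀ _ hj.ne', hI1] at this
    exact this
  obtain ⟨r, hr, hFr⟩ := intermediate_value_Icc (div_pos hw1 hj).le hF.continuousOn
    (⟨hF0.le.trans zero_le_one, hF1⟩ : (1 : ℝ) ∈ Set.Icc (F 0) (F (warp 1 / α j)))
  have hr0 : 0 < r := by
    refine lt_of_le_of_ne hr.1 ?_
    rintro rfl
    rw [hF0] at hFr
    exact zero_ne_one hFr
  have hx : (fun i => I.symm (r * α i)) ∈ simplex₃ :=
    ⟨fun i => hInn _ (mul_nonneg hr.1 (hα i)), hFr⟩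
  refine ⟨_, hx, ?_⟩
  have hwarp : warp ∘ (fun i => I.symm (r * α i)) = r • α := by
    funext i
    rw [Function.comp, ← hGeq _ ⟨hx.1 i, simplex₃_le_one hx i⟩, hGI]
    rfl
  rw [pt, hwarp, lin_smul, norm_smul, hc, mul_one, Real.norm_of_nonneg hr.1, smul_smul,
    inv_mul_cancel₀ hr0.ne', one_smul]

/-- The size of the displacement of `x` under `reflect i i'`, signed. -/
def height (i i' : Fin 12) (x : E3) : ℝ := inner ℝ x (ico i - ico i') / goldenRatio

theorem IsOpp.dist_sq' {i i' : Fin 12} (h : IsOpp i i') (x y : E3) :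
    dist x y ^ 2 = dist x (reflect i i' y) ^ 2 - height i i' x * height i i' y := by
  have hφ := goldenRatio_pos
  rw [h.dist_sq, height, height]
  generalize goldenRatio = p at *
  field_simp

theorem IsOpp.height_reflect {i i' : Fin 12} (h : IsOpp i i') (x : E3) :
    height i i' (reflect i i' x) = -height i i' x := by
  rw [height, h.inner_reflect, neg_div, height]

theorem IsOpp.dist_reflect_sq {i i' : Fin 12} (h : IsOpp i i') (x : E3) :
    dist (reflect i i' x) x ^ 2 = height i i' x ^ 2 := by
  rw [h.dist_sq', dist_self, h.height_reflect]
  ring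

theorem IsTri.height_pt {t : Fin 3 → Fin 12} (ht : IsTri t) {a : Fin 3} {i' : Fin 12}
    (ho : IsOpp (t a) i') (h : ∀ b, b ≠ a → icoDot (t b) i' = ⟨0, 1⟩) (x : Fin 3 → ℝ) :
    height (t a) i' (pt t x) = ‖lin t (warp ∘ x)‖⁻¹ * (warp (x a) * (2 * goldenRatio)) := by
  have hφ := goldenRatio_pos
  rw [height, pt, real_inner_smul_left, ht.inner_lin_sub ho h, Function.comp]
  generalize goldenRatio = p at *
  field_simp

/-- Separation on each face and a lower bound for heights propagate to the whole net by
folding. -/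
theorem net_separated {n : ℕ} (hn : 0 < n) {s ρ κ : ℝ} (hs : 0 < s) (hsρ : s ≤ 2 * ρ)
    (hface : ∀ t, IsTri t → ∀ a b : Fin 3 → ℕ, ∑ i, a i = n → ∑ i, b i = n → a ≠ b →
      s ≤ dist (pt t (grid n a)) (pt t (grid n b)) ∧
      (dist (pt t (grid n a)) (pt t (grid n b)) ≤ κ * s ∨
        2 * ρ < dist (pt t (grid n a)) (pt t (grid n b))))
    (hheight : ∀ t, IsTri t → ∀ a : Fin 3 → ℕ, ∑ i, a i = n → ∀ j i', IsOpp (t j) i' →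
      (∀ b, b ≠ j → icoDot (t b) i' = ⟨0, 1⟩) → a j ≠ 0 →
      2 * ρ < height (t j) i' (pt t (grid n a)) ∧
      (2 * ρ) ^ 2 < s ^ 2 + height (t j) i' (pt t (grid n a)) * s) :
    ∀ A ∈ net n, ∀ B ∈ net n, A ≠ B → s ≤ dist A B ∧ (dist A B ≤ κ * s ∨ 2 * ρ < dist A B) := by
  have height_zero : ∀ t, IsTri t → ∀ a : Fin 3 → ℕ, ∀ j i', IsOpp (t j) i' →
      (∀ b, b ≠ j → icoDot (t b) i' = ⟨0, 1⟩) → a j = 0 →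
      height (t j) i' (pt t (grid n a)) = 0 := by
    intro t ht a j i' ho h h0
    rw [ht.height_pt ho h, grid, h0, Nat.cast_zero, zero_div, warp_zero]
    ring
  have refl_dist : ∀ {i i' : Fin 12} {A B : E3}, IsOpp i i' → height i i' A = 0 →
      dist A B = dist A (reflect i i' B) := by
    intro i i' A B ho h0
    have := ho.dist_sq' A B
    rw [h0, zero_mul, sub_zero] at this
    exact (sq_eq_sq₀ dist_nonneg dist_nonneg).1 this
  have refl_dist_self : ∀ {i i' : Fin 12} {A B : E3}, IsOpp i i' → 0 ≤ height i i' A →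
      A = reflect i i' B → dist A B = height i i' A := by
    intro i i' A B ho h0 h
    have := ho.dist_reflect_sq B
    have e := ho.height_reflect B
    rw [← h] at this e
    exact (sq_eq_sq₀ dist_nonneg h0).1 (by rw [this, e, neg_sq])
  have neg_height : ∀ {i i' : Fin 12} {B : E3}, inner ℝ B (ico i - ico i') < 0 →
      height i i' B < 0 := fun h => div_neg_of_neg_of_pos h goldenRatio_pos
  have sep : ∀ A ∈ net n, ∀ B ∈ net n, A = B ∨ s ≤ dist A B := by
    rintro A ⟨t, ht, a, ha, rfl⟩
    refine net_fold_induction ht ?_ ?_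
    · intro B hB β hβ hBβ
      obtain ⟨b, hb, rfl⟩ := exists_grid_of_mem_cone hn hB ht hβ hBβ
      by_cases hab : a = b
      · exact .inl (by rw [hab])
      · exact .inr (hface t ht a b ha hb hab).1
    · intro j i' ho h B hB hneg hP
      have hnegh := neg_height hneg
      by_cases h0 : a j = 0
      · have hz := height_zero t ht a j i' ho h h0
        rw [refl_dist ho hz]
        refine hP.imp_left fun hAB => ?_
        have := refl_dist_self ho hz.ge hAB
        rw [hz] at this
        exact dist_eq_zero.1 this
      · have hh := (hheight t ht a ha j i' ho h h0).1
        right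
        rcases hP with hP | hP
        · rw [refl_dist_self ho (by linarith) hP]; linarith
        · have := ho.dist_sq' (pt t (grid n a)) B
          refine hP.trans ((sq_le_sq₀ dist_nonneg dist_nonneg).1 ?_)
          nlinarith
  have gap : ∀ A ∈ net n, ∀ B ∈ net n, A = B ∨ dist A B ≤ κ * s ∨ 2 * ρ < dist A B := by
    rintro A hA
    obtain ⟨t, ht, a, ha, rfl⟩ := hA
    refine net_fold_induction ht ?_ ?_
    · intro B hB β hβ hBβ
      obtain ⟨b, hb, rfl⟩ := exists_grid_of_mem_cone hn hB ht hβ hBβ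
      by_cases hab : a = b
      · exact .inl (by rw [hab])
      · exact .inr (hface t ht a b ha hb hab).2
    · intro j i' ho h B hB hneg hP
      have hnegh := neg_height hneg
      by_cases h0 : a j = 0
      · have hz := height_zero t ht a j i' ho h h0
        rw [refl_dist ho hz]
        refine hP.imp_left fun hAB => ?_
        have := refl_dist_self ho hz.ge hAB
        rw [hz] at this
        exact dist_eq_zero.1 this
      · obtain ⟨hh, hh2⟩ := hheight t ht a ha j i' ho h h0
        right; right
        have hB' := ho.reflect_mem_net hB
        rcases sep _ ⟨t, ht, a, ha, rfl⟩ _ hB' with hP | hP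
        · rw [refl_dist_self ho (by linarith) hP]; exact hh
        · have e1 := ho.dist_sq' (pt t (grid n a)) B
          have e2 := ho.dist_reflect_sq B
          have e3 : s ≤ -height (t j) i' B := by
            rcases sep _ hB' _ hB with h' | h'
            · rw [h', dist_self] at e2
              nlinarith
            · refine h'.trans ((sq_le_sq₀ dist_nonneg (by linarith)).1 ?_)
              rw [e2, neg_sq]
          refine (sq_lt_sq₀ (by linarith) dist_nonneg).1 (hh2.trans_le ?_)
          rw [e1]
          have := mul_le_mul_of_nonneg_left e3 (by linarith : 0 ≤ height (t j) i' (pt t (grid n a)))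
          nlinarith
  exact fun A hA B hB hAB => ⟨(sep A hA B hB).resolve_left hAB, (gap A hA B hB).resolve_left hAB⟩

theorem warp_bounds {x : ℝ} (hx : 0 ≤ x) (hx1 : x ≤ 1) :
    4320 * x * (1 - x) ≤ warp x ∧ warp x ≤ 4320 * x := by
  obtain ⟨h1, h2⟩ := goldenRatio_near
  unfold warp gHom
  generalize goldenRatio = p at *
  have x2 : x ^ 2 ≤ x := by nlinarith
  have x3 : x ^ 3 ≤ x := by nlinarith [sq_nonneg x]
  have x30 : 0 ≤ x ^ 3 := by positivity
  have k1 : (13648 - 9216 * p) * x ≤ -1263 * x := mul_le_mul_of_nonneg_right (by linarith) hx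
  have k1' : -1266 * x ≤ (13648 - 9216 * p) * x := mul_le_mul_of_nonneg_right (by linarith) hx
  have k2 : (-14263 + 9216 * p) * x ^ 2 ≤ 650 * x ^ 2 :=
    mul_le_mul_of_nonneg_right (by linarith) (sq_nonneg x)
  have k2' : 0 ≤ (-14263 + 9216 * p) * x ^ 2 := mul_nonneg (by linarith) (sq_nonneg x)
  constructor
  · have : 4320 - 4320 * x ≤ 4320 * 1 ^ 3 + (13648 - 9216 * p) * 1 ^ 2 * x +
        (-14263 + 9216 * p) * 1 * x ^ 2 - 195 * x ^ 3 := by linarith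
    have := mul_le_mul_of_nonneg_left this hx
    linarith
  · have : 4320 * 1 ^ 3 + (13648 - 9216 * p) * 1 ^ 2 * x +
        (-14263 + 9216 * p) * 1 * x ^ 2 - 195 * x ^ 3 ≤ 4320 := by linarith
    have := mul_le_mul_of_nonneg_left this hx
    linarith

theorem IsTri.norm_lin_le {t : Fin 3 → Fin 12} (ht : IsTri t) {x : Fin 3 → ℝ}
    (hx : x ∈ simplex₃) : ‖lin t (warp ∘ x)‖ ≤ 1.9022 * 4320 := by
  obtain ⟨-, hφ⟩ := goldenRatio_near
  have hφ0 := goldenRatio_pos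
  refine (sq_le_sq₀ (norm_nonneg _) (by norm_num)).1 ?_
  rw [ht.norm_lin_warp_sq, normSq, normForm]
  have hs := hx.2
  rw [Fin.sum_univ_three] at hs
  have b : ∀ i, 0 ≤ warp (x i) ∧ warp (x i) ≤ 4320 * x i := fun i =>
    ⟨warp_comp_nonneg hx i, (warp_bounds (hx.1 i) (simplex₃_le_one hx i)).2⟩
  have h1 : (warp (x 0) + warp (x 1) + warp (x 2)) ^ 2 ≤ 4320 ^ 2 :=
    pow_le_pow_left₀ (by linarith [(b 0).1, (b 1).1, (b 2).1])
      (by linarith [(b 0).2, (b 1).2, (b 2).2]) 2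
  have h2 : warp (x 0) ^ 2 + warp (x 1) ^ 2 + warp (x 2) ^ 2 ≤ 4320 ^ 2 := by
    have m01 := mul_nonneg (b 0).1 (b 1).1
    have m12 := mul_nonneg (b 1).1 (b 2).1
    have m20 := mul_nonneg (b 2).1 (b 0).1
    nlinarith
  have h3 := mul_le_mul_of_nonneg_left h1 hφ0.le
  generalize goldenRatio = p at *
  norm_num at *
  linarith

theorem IsTri.le_height {t : Fin 3 → Fin 12} (ht : IsTri t) {n : ℕ} (hn : 20 ≤ n)
    {a : Fin 3 → ℕ} (ha : ∑ i, a i = n) {j : Fin 3} {i' : Fin 12} (ho : IsOpp (t j) i')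
    (h : ∀ b, b ≠ j → icoDot (t b) i' = ⟨0, 1⟩) (hj : a j ≠ 0) :
    1.6 ≤ n * height (t j) i' (pt t (grid n a)) := by
  obtain ⟨hφ, -⟩ := goldenRatio_near
  have hx := grid_mem (by omega) ha
  have hn20 : (20 : ℝ) ≤ n := by exact_mod_cast hn
  have hn' : (0 : ℝ) < n := by linarith
  rw [ht.height_pt ho h]
  have hpos := ht.norm_lin_pos hx
  have hle := ht.norm_lin_le hx
  have hinv : (n : ℝ)⁻¹ ≤ grid n a j := by
    unfold grid
    rw [inv_eq_one_div]
    have : (1 : ℝ) ≤ a j := by exact_mod_cast Nat.one_le_iff_ne_zero.2 hj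
    gcongr
  have hn1 : (n : ℝ)⁻¹ ≤ 1 := inv_le_one_of_one_le₀ (by linarith)
  have hw1 : warp (n : ℝ)⁻¹ ≤ warp (grid n a j) :=
    warp_strictMonoOn.monotoneOn ⟨by positivity, hn1⟩ ⟨hx.1 j, simplex₃_le_one hx j⟩ hinv
  have hw2 := (warp_bounds (by positivity : 0 ≤ (n : ℝ)⁻¹) hn1).1
  have hw3 : 4320 * 0.95 ≤ n * warp (grid n a j) := by
    have h05 : (n : ℝ)⁻¹ ≤ 0.05 := by
      rw [inv_le_comm₀ hn' (by norm_num)]; norm_num; linarith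
    have := mul_le_mul_of_nonneg_left (hw2.trans hw1) hn'.le
    have e : (n : ℝ) * (4320 * (n : ℝ)⁻¹ * (1 - (n : ℝ)⁻¹)) = 4320 * (1 - (n : ℝ)⁻¹) := by
      field_simp
    rw [e] at this
    linarith
  rw [mul_left_comm, inv_mul_eq_div, le_div_iff₀ hpos]
  have h4 : 4320 * 0.95 * (2 * goldenRatio) ≤ n * warp (grid n a j) * (2 * goldenRatio) :=
    mul_le_mul_of_nonneg_right hw3 (by linarith)
  generalize goldenRatio = p at *
  norm_num at *
  linarith

theorem le_card_net {n : ℕ} (hn : 0 < n) : n ≤ (net_finite n).toFinset.card := by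
  obtain ⟨t, ht⟩ := exists_isTri
  have hn' : (n : ℝ) ≠ 0 := by positivity
  have hsum : ∀ k < n, ∑ i, (![k, n - k, 0] : Fin 3 → ℕ) i = n := fun k hk => by
    simp [Fin.sum_univ_three]; omega
  have := Finset.card_le_card_of_injOn (s := Finset.range n) (t := (net_finite n).toFinset)
    (fun k => pt t (grid n ![k, n - k, 0])) (fun k hk => by
      have hk := Finset.mem_range.1 hk
      simp only [Set.Finite.coe_toFinset]
      exact ⟨t, ht, _, hsum k hk, rfl⟩) (by
      intro k hk l hl hkl
      have hk := Finset.mem_range.1 hk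
      have hl := Finset.mem_range.1 hl
      have := congrFun (ht.pt_injOn (grid_mem hn (hsum k hk)) (grid_mem hn (hsum l hl)) hkl) 0
      simp only [grid] at this
      rw [div_left_inj' hn'] at this
      simpa using this)
  simpa using this

theorem four_mul_sin_sq : (2 * Real.sin (π / 5)) ^ 2 = 3 - goldenRatio := by
  have h := Real.sin_sq (π / 5)
  rw [Real.cos_pi_div_five] at h
  have h5 : √5 ^ 2 = (5 : ℝ) := Real.sq_sqrt (by norm_num)
  rw [mul_pow, h, goldenRatio]
  nlinarith

/-- The warped icosahedral subdivisions are nets with ratio close to `2 sin 36°`. -/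
theorem exists_isNet_of_small {ε : ℝ} (h0 : 0 < ε) (hε : ε ≤ 1 / 40) (N : ℕ) :
    ∃ (V : Finset E3) (s ρ : ℝ), IsNet V s ρ (2 * Real.sin (π / 5) + 4 * ε) ∧ N ≤ V.card := by
  obtain ⟨hφ, hφ'⟩ := goldenRatio_near
  set κ := 2 * Real.sin (π / 5) + 4 * ε with hκ
  have hsin : 1 < 2 * Real.sin (π / 5) ∧ 2 * Real.sin (π / 5) < 1.2 := by
    have h1 := four_mul_sin_sq
    have h2 : 0 < Real.sin (π / 5) :=
      Real.sin_pos_of_pos_of_lt_pi (by positivity) (by linarith [Real.pi_pos])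
    generalize goldenRatio = p at *
    constructor <;> nlinarith
  have hκ2 : 3 - goldenRatio + 8 * ε ≤ κ ^ 2 := by
    rw [hκ, add_sq, four_mul_sin_sq]
    generalize goldenRatio = p at *
    nlinarith
  obtain ⟨ω, hω, hω2⟩ : ∃ ω : ℝ, 0 < ω ∧ ω ^ 2 = 1024 / 845 :=
    ⟨√(1024 / 845), by positivity, Real.sq_sqrt (by norm_num)⟩
  have hω1 : ω < 1.101 := by nlinarith
  have hω1' : 1 < ω := by nlinarith
  have ev1 : ∀ᶠ n : ℕ in atTop, ∀ t, IsTri t → _ := eventually_all.2 fun t =>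
    eventually_imp_distrib_left.2 fun ht : IsTri t => ht.eventually_separated h0 (by linarith)
  have ev2 : ∀ᶠ n : ℕ in atTop, ∀ t, IsTri t → _ := eventually_all.2 fun t =>
    eventually_imp_distrib_left.2 fun ht : IsTri t => ht.eventually_covering
  obtain ⟨n, hsep, hcov, hn20, hnN⟩ :=
    (ev1.and (ev2.and ((eventually_ge_atTop 20).and (eventually_ge_atTop N)))).exists
  have hn : 0 < n := by omega
  have hn20' : (20 : ℝ) ≤ n := by exact_mod_cast hn20
  have hn' : (0 : ℝ) < n := by linarith
  have hs : 0 < (1 - ε) * ω / n := by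
    have : 0 < 1 - ε := by linarith
    positivity
  refine ⟨(net_finite n).toFinset, (1 - ε) * ω / n, 0.7 * ω / n, ⟨?_, hs, ?_, ?_, ?_, ?_⟩,
    hnN.trans (le_card_net hn)⟩
  · rintro v hv
    obtain ⟨t, ht, a, ha, rfl⟩ := (Set.Finite.mem_toFinset _).1 hv
    exact ht.norm_pt (grid_mem hn ha)
  · rw [div_lt_one hn']; linarith
  · have h1 : 0 ≤ κ := by linarith
    have h2 : κ ≤ 1.3 := by linarith
    nlinarith
  · intro A hA B hB
    refine net_separated hn hs ?_ ?_ ?_ A ((Set.Finite.mem_toFinset _).1 hA) B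
      ((Set.Finite.mem_toFinset _).1 hB)
    · rw [← mul_div_assoc]
      exact div_le_div_of_nonneg_right (by nlinarith) hn'.le
    · intro t ht a b ha hb hab
      obtain ⟨h1, h2⟩ := hsep t ht a b ha hb hab
      rw [← hω2, ← mul_pow] at h1 h2
      set d := dist (pt t (grid n a)) (pt t (grid n b))
      have hd : 0 ≤ n * d := mul_nonneg hn'.le dist_nonneg
      have hω20 : 0 < ω ^ 2 := by positivity
      constructor
      · rw [div_le_iff₀' hn']
        refine (sq_le_sq₀ (by nlinarith) hd).1 (le_trans ?_ h1)
        rw [mul_pow]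
        exact mul_le_mul_of_nonneg_right (by nlinarith) hω20.le
      · rw [← mul_div_assoc, ← mul_div_assoc, le_div_iff₀' hn', div_lt_iff₀' hn']
        refine h2.imp (fun h2 => ?_) fun h2 => ?_
        · refine (sq_le_sq₀ hd (by
            have : 0 ≤ 1 - ε := by linarith
            have : 0 ≤ κ := by linarith
            positivity)).1 (h2.trans ?_)
          rw [← mul_assoc, mul_pow]
          refine mul_le_mul_of_nonneg_right ?_ hω20.le
          rw [mul_pow]
          have hsq : 1 - 2 * ε ≤ (1 - ε) ^ 2 := by nlinarith
          have h3 : (3 - goldenRatio + 8 * ε) * (1 - 2 * ε) ≤ κ ^ 2 * (1 - ε) ^ 2 :=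
            mul_le_mul hκ2 hsq (by linarith) (sq_nonneg κ)
          generalize goldenRatio = p at *
          nlinarith
        · refine (sq_lt_sq₀ (by positivity) hd).1 (lt_of_lt_of_le ?_ h2)
          rw [mul_pow, mul_pow]
          norm_num
          linarith
    · intro t ht a ha j i' ho h hj
      have hh := ht.le_height hn20 ha ho h hj
      set H := height (t j) i' (pt t (grid n a))
      constructor
      · rw [← mul_div_assoc, div_lt_iff₀' hn']
        have : 2 * (0.7 * ω) < 1.6 := by norm_num at hω1 ⊢; linarith
        linarith
      · have h1 : (n : ℝ) ^ 2 * (2 * (0.7 * ω / n)) ^ 2 = 1.96 * ω ^ 2 := by field_simp; norm_num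
        have h2 : (n : ℝ) ^ 2 * (((1 - ε) * ω / n) ^ 2 + H * ((1 - ε) * ω / n)) =
            (1 - ε) ^ 2 * ω ^ 2 + (n * H) * ((1 - ε) * ω) := by field_simp
        refine lt_of_mul_lt_mul_left (a := (n : ℝ) ^ 2) ?_ (by positivity)
        rw [h1, h2]
        have h3 : 1.6 * (0.975 * ω) ≤ (n * H) * ((1 - ε) * ω) :=
          mul_le_mul hh (mul_le_mul_of_nonneg_right (by norm_num; linarith) hω.le)
            (by positivity) (by linarith)
        have h4 : 0.95 * ω ^ 2 ≤ (1 - ε) ^ 2 * ω ^ 2 :=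
          mul_le_mul_of_nonneg_right (by norm_num; nlinarith) (by positivity)
        have h5 : ω ^ 2 ≤ 1.101 * ω := by
          rw [sq]; exact mul_le_mul_of_nonneg_right hω1.le hω.le
        norm_num at h3 h4 h5 ⊢
        linarith
  · intro c hc
    obtain ⟨t, ht, x, hx, rfl⟩ := exists_pt_eq hc
    obtain ⟨a, ha, h⟩ := hcov t ht x hx
    refine ⟨pt t (grid n a), (Set.Finite.mem_toFinset _).2 ⟨t, ht, a, ha, rfl⟩, ?_⟩
    rw [le_div_iff₀' hn']
    refine (sq_le_sq₀ (by positivity) (by positivity)).1 ?_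
    rw [mul_pow, mul_pow, hω2]
    refine h.trans_eq ?_
    norm_num

end

/-- `liminf_{m→∞} e_m ≤ 2 sin 36° = 2 sin(π/5)`, the liminf being taken along those `m`
for which inscribed polyhedra with `m` triangular faces exist. -/
theorem liminf_e_le_two_sin :
    Filter.liminf e (Filter.atTop ⊓ Filter.principal {m : ℕ | Nonempty (InscribedTriPoly m)}) ≤
      2 * Real.sin (π / 5) := by
  refine le_of_forall_pos_le_add fun ε hε => ?_
  have hε' : 0 < min (ε / 4) (1 / 40) := by positivity
  have hsin : 0 ≤ Real.sin (π / 5) :=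
    Real.sin_nonneg_of_nonneg_of_le_pi (by positivity) (by linarith [Real.pi_pos])
  refine (liminf_e_le_of_forall_exists_isNet (by positivity) fun N =>
    exists_isNet_of_small hε' (min_le_right _ _) N).trans ?_
  linarith [min_le_left (ε / 4) (1 / 40)]
end
end

section
/- Let λ be a real number with 0 < λ < 1. Then the function x ↦ sin(λx)/sin x is monotone increasing on the interval (0, π/2]. -/
open scoped Real

/-- The numerator of the derivative of `sin (l * x) / sin x` is nonnegative on `[0, π]`. -/
lemma sin_mul_cos_le_mul_cos_mul_sin {l x : ℝ} (hl0 : 0 ≤ l) (hl1 : l ≤ 1)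
    (hx : x ∈ Set.Icc 0 π) :
    Real.sin (l * x) * Real.cos x ≤ Real.cos (l * x) * l * Real.sin x := by
  have hd (y : ℝ) : HasDerivAt
      (fun y : ℝ => Real.cos (l * y) * l * Real.sin y - Real.sin (l * y) * Real.cos y)
      ((1 - l ^ 2) * (Real.sin (l * y) * Real.sin y)) y := by
    have h : HasDerivAt (fun y : ℝ => l * y) l y := by
      simpa using (hasDerivAt_id y).const_mul l
    exact (((h.cos.mul_const l).mul (Real.hasDerivAt_sin y)).sub
      (h.sin.mul (Real.hasDerivAt_cos y))).congr_deriv (by ring)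
  have hmono := monotoneOn_of_deriv_nonneg (convex_Icc 0 π)
    (fun y _ => (hd y).continuousAt.continuousWithinAt)
    (fun y _ => (hd y).differentiableAt.differentiableWithinAt) (fun y hy => by
      rw [interior_Icc] at hy
      rw [(hd y).deriv]
      have hly : l * y ≤ π := by nlinarith [hy.1, hy.2]
      exact mul_nonneg (by nlinarith)
        (mul_nonneg (Real.sin_nonneg_of_nonneg_of_le_pi (mul_nonneg hl0 hy.1.le) hly)
          (Real.sin_nonneg_of_nonneg_of_le_pi hy.1.le hy.2.le)))
  have := hmono (Set.left_mem_Icc.2 Real.pi_pos.le) hx hx.1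
  simpa using this

/-- For `0 < λ < 1`, the function `x ↦ sin(λx)/sin x` is monotone increasing on `(0, π/2]`. -/
theorem sin_ratio_monotone (l : ℝ) (hl0 : 0 < l) (hl1 : l < 1) :
    MonotoneOn (fun x : ℝ => Real.sin (l * x) / Real.sin x) (Set.Ioc 0 (π / 2)) := by
  have hpi := Real.pi_pos
  have hs {x : ℝ} (hx : x ∈ Set.Ioc 0 (π / 2)) : 0 < Real.sin x :=
    Real.sin_pos_of_pos_of_lt_pi hx.1 (by linarith [hx.2])
  have hd {x : ℝ} (hx : x ∈ Set.Ioc 0 (π / 2)) :=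
    ((((hasDerivAt_id x).const_mul l).sin).div (Real.hasDerivAt_sin x) (hs hx).ne')
  refine monotoneOn_of_deriv_nonneg (convex_Ioc 0 (π / 2))
    (fun x hx => (hd hx).continuousAt.continuousWithinAt)
    (fun x hx => (hd (interior_subset hx)).differentiableAt.differentiableWithinAt)
    (fun x hx => ?_)
  have hx' := interior_subset hx
  refine (hd hx').deriv.symm ▸ div_nonneg ?_ (sq_nonneg _)
  have := sin_mul_cos_le_mul_cos_mul_sin hl0.le hl1.le ⟨hx'.1.le, by linarith [hx'.2]⟩
  simpa using this
end
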